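/- Estimate of the term I₄: there exists a constant C > 0 depending only on τ₀ such that, under the standing assumptions, ∑_{n≥0} ∑_{|α|=n} |I^α_4| τⁿ Mₙ / ‖θ ⟨r⟩ⁿ ∂^α_h g‖_{L²} ≤ C τ^{−2} ⟨t⟩^{−1/4} ( ‖g‖_{X_τ} + ‖g‖_{Y_τ} ) ‖g‖_{X_τ}. -/

import Mathlib

open MeasureTheory Filter Set

noncomputable section

/-- `⟨t⟩ = 1 + t` -/
def angT (t : ℝ) : ℝ := 1 + t

/-- `θ_λ(z) = exp (λ z² / (8⟨t⟩))`; `θ = θ₁`. -/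
def thw (t lam z : ℝ) : ℝ := Real.exp (lam * z ^ 2 / (8 * angT t))

/-- `⟨r⟩ = √(x² + y² + 1)` -/
def angR (x y : ℝ) : ℝ := Real.sqrt (x ^ 2 + y ^ 2 + 1)

/-- `Mₙ = (n+1)⁴ / n!` -/
def Mfac (n : ℕ) : ℝ := ((n : ℝ) + 1) ^ 4 / (n.factorial : ℝ)

/-- `∂_x` -/
def pdx (f : ℝ → ℝ → ℝ → ℝ) : ℝ → ℝ → ℝ → ℝ := fun x y z => deriv (fun x' => f x' y z) x
/-- `∂_y` -/
def pdy (f : ℝ → ℝ → ℝ → ℝ) : ℝ → ℝ → ℝ → ℝ := fun x y z => deriv (fun y' => f x y' z) y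
/-- `∂_z` -/
def pdz (f : ℝ → ℝ → ℝ → ℝ) : ℝ → ℝ → ℝ → ℝ := fun x y z => deriv (fun z' => f x y z') z

/-- `∂^α_h = ∂_x^{α₁} ∂_y^{α₂}` for the multi-index `α = (a, b)` -/
def pdh (a b : ℕ) (f : ℝ → ℝ → ℝ → ℝ) : ℝ → ℝ → ℝ → ℝ := pdx^[a] (pdy^[b] f)

/-- `r ∂_r = x ∂_x + y ∂_y` -/
def rdr (f : ℝ → ℝ → ℝ → ℝ) : ℝ → ℝ → ℝ → ℝ := fun x y z => x * pdx f x y z + y * pdy f x y z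

/-- weighted `L²` norm over `ℝ² × (0,∞)` of `θ_λ ⟨r⟩ⁿ f` -/
def L2w (t lam : ℝ) (n : ℕ) (f : ℝ → ℝ → ℝ → ℝ) : ℝ :=
  Real.sqrt (∫ x : ℝ, ∫ y : ℝ, ∫ z in Ioi (0 : ℝ), (thw t lam z * angR x y ^ n * f x y z) ^ 2)

/-- weighted `L²_z` norm at fixed `(x, y)` of `θ_λ ⟨r⟩ⁿ f (x, y, ·)` -/
def L2z (t lam : ℝ) (n : ℕ) (f : ℝ → ℝ → ℝ → ℝ) (x y : ℝ) : ℝ :=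
  Real.sqrt (∫ z in Ioi (0 : ℝ), (thw t lam z * angR x y ^ n * f x y z) ^ 2)

/-- mixed `L^∞_h L²_z` norm of `θ_λ ⟨r⟩ⁿ f` -/
def LIh2z (t lam : ℝ) (n : ℕ) (f : ℝ → ℝ → ℝ → ℝ) : ℝ :=
  Real.sqrt (∫ z in Ioi (0 : ℝ), (⨆ p : ℝ × ℝ, |thw t lam z * angR p.1 p.2 ^ n * f p.1 p.2 z|) ^ 2)

/-- mixed `L²_h L^∞_z` norm of `θ_λ ⟨r⟩ⁿ f` -/
def L2hIz (t lam : ℝ) (n : ℕ) (f : ℝ → ℝ → ℝ → ℝ) : ℝ :=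
  Real.sqrt (∫ x : ℝ, ∫ y : ℝ,
    (⨆ z : Ioi (0 : ℝ), |thw t lam (z : ℝ) * angR x y ^ n * f x y (z : ℝ)|) ^ 2)

/-- the primitive `φ(x,y,z) = exp(−z²/(4⟨t⟩)) ∫₀^z g(x,y,s) exp(s²/(4⟨t⟩)) ds` -/
def phiF (t : ℝ) (g : ℝ → ℝ → ℝ → ℝ) : ℝ → ℝ → ℝ → ℝ := fun x y z =>
  Real.exp (-(z ^ 2) / (4 * angT t)) * ∫ s in (0 : ℝ)..z, g x y s * Real.exp (s ^ 2 / (4 * angT t))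

/-- `u^r = ∂_z φ` -/
def ur (t : ℝ) (g : ℝ → ℝ → ℝ → ℝ) : ℝ → ℝ → ℝ → ℝ := pdz (phiF t g)

/-- `u^z = −(x∂_x + y∂_y)φ − 2φ` -/
def uzv (t : ℝ) (g : ℝ → ℝ → ℝ → ℝ) : ℝ → ℝ → ℝ → ℝ := fun x y z =>
  -(rdr (phiF t g) x y z) - 2 * phiF t g x y z

/-- smoothness together with rapid decay in `z` of all derivatives -/
def DecaySmooth (g : ℝ → ℝ → ℝ → ℝ) : Prop :=
  ContDiff ℝ (⊤ : ℕ∞) (fun p : ℝ × ℝ × ℝ => g p.1 p.2.1 p.2.2) ∧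
  ∀ a b k m : ℕ, ∀ x y : ℝ,
    Tendsto (fun z : ℝ => z ^ m * pdz^[k] (pdh a b g) x y z) atTop (nhds 0)

/-- `θ ⟨r⟩^{|α|} ∂^α_h g ∈ L²(ℝ² × (0,∞))` for every `α` -/
def L2cond (t : ℝ) (g : ℝ → ℝ → ℝ → ℝ) : Prop :=
  ∀ a b : ℕ,
    Integrable
      (fun p : ℝ × ℝ × ℝ =>
        (thw t 1 p.2.2 * angR p.1 p.2.1 ^ (a + b) * pdh a b g p.1 p.2.1 p.2.2) ^ 2)
      (volume.restrict {p : ℝ × ℝ × ℝ | 0 < p.2.2})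

/-- `θ ⟨r⟩^{|α|} ∂^α_h ∂_z g ∈ L²(ℝ² × (0,∞))` for every `α` -/
def L2condZ (t : ℝ) (g : ℝ → ℝ → ℝ → ℝ) : Prop :=
  ∀ a b : ℕ,
    Integrable
      (fun p : ℝ × ℝ × ℝ =>
        (thw t 1 p.2.2 * angR p.1 p.2.1 ^ (a + b) * pdh a b (pdz g) p.1 p.2.1 p.2.2) ^ 2)
      (volume.restrict {p : ℝ × ℝ × ℝ | 0 < p.2.2})

/-- `X_n(g, τ)` -/
def Xel (t τ : ℝ) (g : ℝ → ℝ → ℝ → ℝ) (n : ℕ) : ℝ :=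
  (∑ a ∈ Finset.range (n + 1), L2w t 1 n (pdh a (n - a) g)) * τ ^ n * Mfac n

/-- `D_n(g, τ) = X_n(∂_z g, τ)` -/
def Del (t τ : ℝ) (g : ℝ → ℝ → ℝ → ℝ) (n : ℕ) : ℝ :=
  (∑ a ∈ Finset.range (n + 1), L2w t 1 n (pdh a (n - a) (pdz g))) * τ ^ n * Mfac n

/-- `Y_n(g, τ)` (with `Y₀ = 0`) -/
def Yel (t τ : ℝ) (g : ℝ → ℝ → ℝ → ℝ) (n : ℕ) : ℝ :=
  (∑ a ∈ Finset.range (n + 1), L2w t 1 n (pdh a (n - a) g)) * τ ^ (n - 1) * (n : ℝ) * Mfac n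

/-- `‖g‖_{X_τ}` -/
def Xnrm (t τ : ℝ) (g : ℝ → ℝ → ℝ → ℝ) : ℝ := ∑' n : ℕ, Xel t τ g n
/-- `‖g‖_{D_τ}` -/
def Dnrm (t τ : ℝ) (g : ℝ → ℝ → ℝ → ℝ) : ℝ := ∑' n : ℕ, Del t τ g n
/-- `‖g‖_{Y_τ}` -/
def Ynrm (t τ : ℝ) (g : ℝ → ℝ → ℝ → ℝ) : ℝ := ∑' n : ℕ, Yel t τ g n

/-- triple integral over `ℝ² × (0,∞)` -/
def trip (F : ℝ → ℝ → ℝ → ℝ) : ℝ := ∫ x : ℝ, ∫ y : ℝ, ∫ z in Ioi (0 : ℝ), F x y z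

/-- `I^α_1` -/
def I1 (t : ℝ) (g : ℝ → ℝ → ℝ → ℝ) (a b : ℕ) : ℝ :=
  -trip fun x y z =>
    thw t 2 z * angR x y ^ (2 * (a + b)) *
      pdh a b (fun x' y' z' => ur t g x' y' z' * rdr g x' y' z') x y z * pdh a b g x y z

/-- `I^α_2` -/
def I2 (t : ℝ) (g : ℝ → ℝ → ℝ → ℝ) (a b : ℕ) : ℝ :=
  -trip fun x y z =>
    thw t 2 z * angR x y ^ (2 * (a + b)) *
      pdh a b (fun x' y' z' => uzv t g x' y' z' * pdz g x' y' z') x y z * pdh a b g x y z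

/-- `I^α_3` -/
def I3 (t : ℝ) (g : ℝ → ℝ → ℝ → ℝ) (a b : ℕ) : ℝ :=
  -trip fun x y z =>
    thw t 2 z * angR x y ^ (2 * (a + b)) *
      pdh a b (fun x' y' z' => ur t g x' y' z' ^ 2) x y z * pdh a b g x y z

/-- `I^α_4` -/
def I4 (t : ℝ) (g : ℝ → ℝ → ℝ → ℝ) (a b : ℕ) : ℝ :=
  (1 / (2 * angT t)) * trip fun x y z =>
    thw t 2 z * angR x y ^ (2 * (a + b)) *
      pdh a b
        (fun x' y' z' =>
          uzv t g x' y' z' * pdz (fun x'' y'' w => w * phiF t g x'' y'' w) x' y' z') x y z *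
      pdh a b g x y z

/-- `I^α_5` -/
def I5 (t : ℝ) (g : ℝ → ℝ → ℝ → ℝ) (a b : ℕ) : ℝ :=
  -(1 / angT t) * trip fun x y z =>
    z * thw t 2 z * angR x y ^ (2 * (a + b)) *
      pdh a b (fun x' y' z' => ur t g x' y' z' * phiF t g x' y' z') x y z * pdh a b g x y z

/-- `I^α_6` -/
def I6 (t : ℝ) (g : ℝ → ℝ → ℝ → ℝ) (a b : ℕ) : ℝ :=
  -(1 / (2 * angT t)) * trip fun x y z =>
    z * thw t 2 z * angR x y ^ (2 * (a + b)) *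
      (∫ s in Ioi z, pdh a b (fun x' y' z' => ur t g x' y' z' ^ 2) x y s) * pdh a b g x y z

/-- `I^α_7` -/
def I7 (t : ℝ) (g : ℝ → ℝ → ℝ → ℝ) (a b : ℕ) : ℝ :=
  (1 / angT t) * trip fun x y z =>
    z * thw t 2 z * angR x y ^ (2 * (a + b)) *
      (∫ s in Ioi z, pdh a b (fun x' y' z' => pdz (ur t g) x' y' z' * uzv t g x' y' z') x y s) *
      pdh a b g x y z

/-- `∑_{|α| = n} |I^α| τⁿ Mₙ / ‖θ ⟨r⟩ⁿ ∂^α_h g‖_{L²}` (with the convention `x / 0 = 0`) -/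
def Qterm (t τ : ℝ) (g : ℝ → ℝ → ℝ → ℝ) (I : ℕ → ℕ → ℝ) (n : ℕ) : ℝ :=
  ∑ a ∈ Finset.range (n + 1), |I a (n - a)| * τ ^ n * Mfac n / L2w t 1 n (pdh a (n - a) g)

/-- `∂_t` -/
def pdt (G : ℝ → ℝ → ℝ → ℝ → ℝ) (t x y z : ℝ) : ℝ := deriv (fun t' => G t' x y z) t

/-- the good-unknown axially symmetric Prandtl equation at the point `(t, x, y, z)` -/
def GoodEq (G : ℝ → ℝ → ℝ → ℝ → ℝ) (t x y z : ℝ) : Prop :=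
  pdt G t x y z
      + ur t (G t) x y z * rdr (G t) x y z
      + uzv t (G t) x y z * pdz (G t) x y z
      - pdz (pdz (G t)) x y z
      + G t x y z / angT t
      + ur t (G t) x y z ^ 2
      - 1 / (2 * angT t) * (uzv t (G t) x y z * pdz (fun x' y' w => w * phiF t (G t) x' y' w) x y z)
      + z / angT t * (ur t (G t) x y z * phiF t (G t) x y z)
      + z / (2 * angT t) * (∫ s in Ioi z, ur t (G t) x y s ^ 2)
      - z / angT t * (∫ s in Ioi z, pdz (ur t (G t)) x y s * uzv t (G t) x y s) = 0

/-- A family `F a b` of continuous functions on `ℝ³` that is closed under horizontal derivatives: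
`∂_x (F a b) = F (a + 1) b` and `∂_y (F a b) = F a (b + 1)`. -/
structure HJet (F : ℕ → ℕ → ℝ → ℝ → ℝ → ℝ) : Prop where
  cont : ∀ a b, Continuous fun p : ℝ × ℝ × ℝ => F a b p.1 p.2.1 p.2.2
  dx : ∀ a b x y z, HasDerivAt (fun x' => F a b x' y z) (F (a + 1) b x y z) x
  dy : ∀ a b x y z, HasDerivAt (fun y' => F a b x y' z) (F a (b + 1) x y z) y

namespace HJet

variable {F H : ℕ → ℕ → ℝ → ℝ → ℝ → ℝ}

theorem pdh_eq (hF : HJet F) (a b : ℕ) : pdh a b (F 0 0) = F a b := by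
  have hy : pdy^[b] (F 0 0) = F 0 b := by
    induction b with
    | zero => rfl
    | succ b ih =>
      rw [Function.iterate_succ_apply', ih]
      funext x y z
      exact (hF.dy 0 b x y z).deriv
  unfold pdh
  rw [hy]
  induction a with
  | zero => rfl
  | succ a ih =>
    rw [Function.iterate_succ_apply', ih]
    funext x y z
    exact (hF.dx a b x y z).deriv

theorem hasDerivAt_leibniz {f h : ℕ → ℝ → ℝ} {x : ℝ}
    (hf : ∀ n, HasDerivAt (f n) (f (n + 1) x) x) (hh : ∀ n, HasDerivAt (h n) (h (n + 1) x) x)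
    (n : ℕ) :
    HasDerivAt
      (fun x => ∑ p ∈ Finset.HasAntidiagonal.antidiagonal n,
        (n.choose p.1 : ℝ) * (f p.1 x * h p.2 x))
      (∑ p ∈ Finset.HasAntidiagonal.antidiagonal (n + 1),
        ((n + 1).choose p.1 : ℝ) * (f p.1 x * h p.2 x)) x := by
  have h1 : HasDerivAt
      (fun x => ∑ p ∈ Finset.HasAntidiagonal.antidiagonal n,
        (n.choose p.1 : ℝ) * (f p.1 x * h p.2 x))
      (∑ p ∈ Finset.HasAntidiagonal.antidiagonal n,
        (n.choose p.1 : ℝ) * (f (p.1 + 1) x * h p.2 x + f p.1 x * h (p.2 + 1) x)) x :=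
    HasDerivAt.fun_sum fun p _ => ((hf p.1).mul (hh p.2)).const_mul _
  convert h1 using 1
  rw [Finset.sum_antidiagonal_choose_succ_mul (fun i j => f i x * h j x) n,
    ← Finset.sum_add_distrib]
  refine Finset.sum_congr rfl fun p hp => ?_
  rw [← Nat.choose_symm_of_eq_add (Finset.HasAntidiagonal.mem_antidiagonal.1 hp).symm]
  ring

theorem mul (hF : HJet F) (hH : HJet H) :
    HJet fun a b x y z => ∑ p ∈ Finset.HasAntidiagonal.antidiagonal a,
      ∑ q ∈ Finset.HasAntidiagonal.antidiagonal b,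
      (a.choose p.1 : ℝ) * (b.choose q.1 : ℝ) * (F p.1 q.1 x y z * H p.2 q.2 x y z) where
  cont a b := by
    refine continuous_finsetSum _ fun p _ => continuous_finsetSum _ fun q _ => ?_
    exact continuous_const.mul ((hF.cont _ _).mul (hH.cont _ _))
  dx a b x y z := by
    have h1 (q : ℕ × ℕ) := hasDerivAt_leibniz (f := fun n x => F n q.1 x y z)
      (h := fun n x => H n q.2 x y z) (fun n => hF.dx n q.1 x y z) (fun n => hH.dx n q.2 x y z) a
    have h2 := HasDerivAt.fun_sum (u := Finset.HasAntidiagonal.antidiagonal b)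
      fun q _ => (h1 q).const_mul (b.choose q.1 : ℝ)
    refine (h2.congr_of_eventuallyEq (Eventually.of_forall fun x' => ?_)).congr_deriv ?_
    · simp only
      rw [Finset.sum_comm]
      refine Finset.sum_congr rfl fun q _ => ?_
      rw [Finset.mul_sum]
      exact Finset.sum_congr rfl fun p _ => by ring
    · rw [Finset.sum_comm]
      refine Finset.sum_congr rfl fun q _ => ?_
      rw [Finset.mul_sum]
      exact Finset.sum_congr rfl fun p _ => by ring
  dy a b x y z := by
    have h1 (p : ℕ × ℕ) := hasDerivAt_leibniz (f := fun n y => F p.1 n x y z)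
      (h := fun n y => H p.2 n x y z) (fun n => hF.dy p.1 n x y z) (fun n => hH.dy p.2 n x y z) b
    have h2 := HasDerivAt.fun_sum (u := Finset.HasAntidiagonal.antidiagonal a)
      fun p _ => (h1 p).const_mul (a.choose p.1 : ℝ)
    refine (h2.congr_of_eventuallyEq (Eventually.of_forall fun x' => ?_)).congr_deriv ?_
    · simp only
      refine Finset.sum_congr rfl fun q _ => ?_
      rw [Finset.mul_sum]
      exact Finset.sum_congr rfl fun p _ => by ring
    · refine Finset.sum_congr rfl fun q _ => ?_
      rw [Finset.mul_sum]
      exact Finset.sum_congr rfl fun p _ => by ring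

theorem add (hF : HJet F) (hH : HJet H) : HJet fun a b x y z => F a b x y z + H a b x y z where
  cont a b := (hF.cont a b).add (hH.cont a b)
  dx a b x y z := (hF.dx a b x y z).add (hH.dx a b x y z)
  dy a b x y z := (hF.dy a b x y z).add (hH.dy a b x y z)

theorem vertical_mul (hF : HJet F) {c : ℝ → ℝ} (hc : Continuous c) :
    HJet fun a b x y z => c z * F a b x y z where
  cont a b := (hc.comp (continuous_snd.comp continuous_snd)).mul (hF.cont a b)
  dx a b x y z := (hF.dx a b x y z).const_mul _
  dy a b x y z := (hF.dy a b x y z).const_mul _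

theorem uz (hF : HJet F) :
    HJet fun a b x y z => -(x * F (a + 1) b x y z + y * F a (b + 1) x y z)
      - (a + b + 2) * F a b x y z where
  cont a b := by
    have h1 := hF.cont (a + 1) b
    have h2 := hF.cont a (b + 1)
    have h3 := hF.cont a b
    fun_prop
  dx a b x y z := by
    have h := ((((hasDerivAt_id x).mul (hF.dx (a + 1) b x y z)).add
      ((hF.dx a (b + 1) x y z).const_mul y)).neg).sub
      ((hF.dx a b x y z).const_mul ((a : ℝ) + b + 2))
    refine h.congr_deriv ?_
    push_cast
    simp only [id]
    ring
  dy a b x y z := by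
    have h := ((((hF.dy (a + 1) b x y z).const_mul x).add
      ((hasDerivAt_id y).mul (hF.dy a (b + 1) x y z))).neg).sub
      ((hF.dy a b x y z).const_mul ((a : ℝ) + b + 2))
    refine h.congr_deriv ?_
    push_cast
    simp only [id]
    ring

end HJet

theorem hasDerivAt_intervalIntegral_of_continuous {f f' : ℝ → ℝ → ℝ}
    (hf : ∀ x, Continuous (f x)) (hf' : Continuous f'.uncurry)
    (hd : ∀ x s, HasDerivAt (fun x' => f x' s) (f' x s) x) (a b x₀ : ℝ) :
    HasDerivAt (fun x => ∫ s in a..b, f x s) (∫ s in a..b, f' x₀ s) x₀ := by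
  obtain ⟨M, hM⟩ := ((isCompact_closedBall x₀ 1).prod (isCompact_uIcc (a := a) (b := b))
    ).exists_bound_of_continuousOn hf'.continuousOn
  refine (intervalIntegral.hasDerivAt_integral_of_dominated_loc_of_deriv_le
    (bound := fun _ => M) (Metric.ball_mem_nhds x₀ one_pos)
    (Eventually.of_forall fun x => (hf x).aestronglyMeasurable)
    ((hf x₀).intervalIntegrable _ _) ?_ ?_ intervalIntegrable_const ?_).2
  · exact (hf'.comp (continuous_const.prodMk continuous_id)).aestronglyMeasurable
  · refine Eventually.of_forall fun s hs x hx => hM (x, s) ⟨Metric.ball_subset_closedBall hx, ?_⟩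
    exact uIoc_subset_uIcc hs
  · exact Eventually.of_forall fun s _ x _ => hd x s

theorem HJet.phiF {F : ℕ → ℕ → ℝ → ℝ → ℝ → ℝ} (hF : HJet F) (t : ℝ) :
    HJet fun a b => phiF t (F a b) where
  cont a b := by
    have h : Continuous fun q : (ℝ × ℝ × ℝ) × ℝ =>
        F a b q.1.1 q.1.2.1 q.2 * Real.exp (q.2 ^ 2 / (4 * angT t)) := by
      refine ((hF.cont a b).comp
        (f := fun q : (ℝ × ℝ × ℝ) × ℝ => (q.1.1, q.1.2.1, q.2)) (by fun_prop)).mul (by fun_prop)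
    have h2 := intervalIntegral.continuous_parametric_intervalIntegral_of_continuous
      (μ := volume) (a₀ := 0)
      (f := fun (p : ℝ × ℝ × ℝ) s => F a b p.1 p.2.1 s * Real.exp (s ^ 2 / (4 * angT t)))
      h (s := fun p => p.2.2) (by fun_prop)
    unfold _root_.phiF
    exact Continuous.mul (by fun_prop) h2
  dx a b x y z := by
    refine (hasDerivAt_intervalIntegral_of_continuous
      (f := fun x s => F a b x y s * Real.exp (s ^ 2 / (4 * angT t)))
      (f' := fun x s => F (a + 1) b x y s * Real.exp (s ^ 2 / (4 * angT t)))
      (fun x => ?_) ?_ (fun x s => ?_) 0 z x).const_mul _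
    · exact ((hF.cont a b).comp (f := fun s => (x, y, s)) (by fun_prop)).mul (by fun_prop)
    · exact ((hF.cont (a + 1) b).comp (f := fun p : ℝ × ℝ => (p.1, y, p.2)) (by fun_prop)).mul
        (by fun_prop)
    · exact (hF.dx a b x y s).mul_const _
  dy a b x y z := by
    refine (hasDerivAt_intervalIntegral_of_continuous
      (f := fun y s => F a b x y s * Real.exp (s ^ 2 / (4 * angT t)))
      (f' := fun y s => F a (b + 1) x y s * Real.exp (s ^ 2 / (4 * angT t)))
      (fun y => ?_) ?_ (fun y s => ?_) 0 z y).const_mul _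
    · exact ((hF.cont a b).comp (f := fun s => (x, y, s)) (by fun_prop)).mul (by fun_prop)
    · exact ((hF.cont a (b + 1)).comp (f := fun p : ℝ × ℝ => (x, p.1, p.2)) (by fun_prop)).mul
        (by fun_prop)
    · exact (hF.dy a b x y s).mul_const _

/-- The joint smoothness of a function of three variables. -/
def SmoothThree (f : ℝ → ℝ → ℝ → ℝ) : Prop :=
  ContDiff ℝ (⊤ : ℕ∞) fun p : ℝ × ℝ × ℝ => f p.1 p.2.1 p.2.2

namespace SmoothThree

variable {f : ℝ → ℝ → ℝ → ℝ}

theorem hasDerivAt_pdx (hf : SmoothThree f) (x y z : ℝ) :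
    HasDerivAt (fun x' => f x' y z)
      (fderiv ℝ (fun p : ℝ × ℝ × ℝ => f p.1 p.2.1 p.2.2) (x, y, z) (1, 0, 0)) x := by
  have h1 : HasFDerivAt (fun p : ℝ × ℝ × ℝ => f p.1 p.2.1 p.2.2) _ (x, y, z) :=
    (hf.differentiable (by simp) (x, y, z)).hasFDerivAt
  exact h1.comp_hasDerivAt (f := fun x' => (x', y, z)) x
    ((hasDerivAt_id x).prodMk ((hasDerivAt_const x y).prodMk (hasDerivAt_const x z)))

theorem hasDerivAt_pdy (hf : SmoothThree f) (x y z : ℝ) :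
    HasDerivAt (fun y' => f x y' z)
      (fderiv ℝ (fun p : ℝ × ℝ × ℝ => f p.1 p.2.1 p.2.2) (x, y, z) (0, 1, 0)) y := by
  have h1 : HasFDerivAt (fun p : ℝ × ℝ × ℝ => f p.1 p.2.1 p.2.2) _ (x, y, z) :=
    (hf.differentiable (by simp) (x, y, z)).hasFDerivAt
  exact h1.comp_hasDerivAt (f := fun y' => (x, y', z)) y
    ((hasDerivAt_const y x).prodMk ((hasDerivAt_id y).prodMk (hasDerivAt_const y z)))

theorem fderiv_apply (hf : SmoothThree f) (v : ℝ × ℝ × ℝ) :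
    ContDiff ℝ (⊤ : ℕ∞)
      fun p => fderiv ℝ (fun p : ℝ × ℝ × ℝ => f p.1 p.2.1 p.2.2) p v :=
  (ContDiff.fderiv_right hf (by simp)).clm_apply contDiff_const

theorem pdx (hf : SmoothThree f) : SmoothThree (pdx f) := by
  have h := hf.fderiv_apply (1, 0, 0)
  unfold SmoothThree
  convert h using 2 with p
  exact (hf.hasDerivAt_pdx _ _ _).deriv

theorem pdy (hf : SmoothThree f) : SmoothThree (pdy f) := by
  have h := hf.fderiv_apply (0, 1, 0)
  unfold SmoothThree
  convert h using 2 with p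
  exact (hf.hasDerivAt_pdy _ _ _).deriv

theorem pdy_pdx (hf : SmoothThree f) : _root_.pdy (_root_.pdx f) = _root_.pdx (_root_.pdy f) := by
  funext x y z
  have e1 : (fun p : ℝ × ℝ × ℝ => _root_.pdx f p.1 p.2.1 p.2.2) =
      fun p => fderiv ℝ (fun p : ℝ × ℝ × ℝ => f p.1 p.2.1 p.2.2) p (1, 0, 0) := by
    funext p; exact (hf.hasDerivAt_pdx _ _ _).deriv
  have e2 : (fun p : ℝ × ℝ × ℝ => _root_.pdy f p.1 p.2.1 p.2.2) =
      fun p => fderiv ℝ (fun p : ℝ × ℝ × ℝ => f p.1 p.2.1 p.2.2) p (0, 1, 0) := by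
    funext p; exact (hf.hasDerivAt_pdy _ _ _).deriv
  have hd : DifferentiableAt ℝ (fderiv ℝ (fun p : ℝ × ℝ × ℝ => f p.1 p.2.1 p.2.2)) (x, y, z) :=
    (ContDiff.fderiv_right (m := (⊤ : ℕ∞)) hf (by simp)).differentiable (by simp) _
  refine (hf.pdx.hasDerivAt_pdy x y z).deriv.trans
    (Eq.trans ?_ (hf.pdy.hasDerivAt_pdx x y z).deriv.symm)
  rw [e1, e2, fderiv_clm_apply hd (by fun_prop), fderiv_clm_apply hd (by fun_prop)]
  simpa using (ContDiff.contDiffAt hf).isSymmSndFDerivAt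
    (by
      rw [minSmoothness_of_isRCLikeNormedField]
      exact WithTop.coe_le_coe.2 (le_top : (2 : ℕ∞) ≤ ⊤)) (0, 1, 0) (1, 0, 0)

theorem iterate_pdx (hf : SmoothThree f) (n : ℕ) : SmoothThree (_root_.pdx^[n] f) := by
  induction n with
  | zero => exact hf
  | succ n ih => rw [Function.iterate_succ_apply']; exact ih.pdx

theorem iterate_pdy (hf : SmoothThree f) (n : ℕ) : SmoothThree (_root_.pdy^[n] f) := by
  induction n with
  | zero => exact hf
  | succ n ih => rw [Function.iterate_succ_apply']; exact ih.pdy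

theorem pdh (hf : SmoothThree f) (a b : ℕ) : SmoothThree (pdh a b f) :=
  (hf.iterate_pdy b).iterate_pdx a

theorem pdy_iterate_pdx (hf : SmoothThree f) (n : ℕ) :
    _root_.pdy (_root_.pdx^[n] f) = _root_.pdx^[n] (_root_.pdy f) := by
  induction n with
  | zero => rfl
  | succ n ih =>
    rw [Function.iterate_succ_apply', (hf.iterate_pdx n).pdy_pdx, ih, Function.iterate_succ_apply']

theorem hjet (hf : SmoothThree f) : HJet fun a b => _root_.pdh a b f where
  cont a b := (hf.pdh a b).continuous
  dx a b x y z := by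
    have h : _root_.pdh (a + 1) b f = _root_.pdx (_root_.pdh a b f) :=
      Function.iterate_succ_apply' _ _ _
    rw [h]
    exact ((hf.pdh a b).hasDerivAt_pdx x y z).differentiableAt.hasDerivAt
  dy a b x y z := by
    have h : _root_.pdh a (b + 1) f = _root_.pdy (_root_.pdh a b f) := by
      unfold _root_.pdh
      rw [(hf.iterate_pdy b).pdy_iterate_pdx, Function.iterate_succ_apply']
    rw [h]
    exact ((hf.pdh a b).hasDerivAt_pdy x y z).differentiableAt.hasDerivAt

end SmoothThree

theorem pdz_mul_phiF {t : ℝ} {f : ℝ → ℝ → ℝ → ℝ}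
    (hf : Continuous fun p : ℝ × ℝ × ℝ => f p.1 p.2.1 p.2.2) (ht : 0 < angT t) (x y z : ℝ) :
    pdz (fun x y w => w * phiF t f x y w) x y z =
      (1 - z ^ 2 / (2 * angT t)) * phiF t f x y z + z * f x y z := by
  have hc : Continuous fun s => f x y s * Real.exp (s ^ 2 / (4 * angT t)) :=
    (hf.comp (f := fun s => (x, y, s)) (by fun_prop)).mul (by fun_prop)
  have h1 := hc.integral_hasStrictDerivAt 0 z
  have h2 : HasDerivAt (fun w : ℝ => Real.exp (-(w ^ 2) / (4 * angT t))) _ z :=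
    ((((hasDerivAt_id z).pow 2).neg).div_const (4 * angT t)).exp
  have h3 := (hasDerivAt_id z).mul (h2.mul h1.hasDerivAt)
  refine h3.deriv.trans ?_
  have he : Real.exp (-(z ^ 2) / (4 * angT t)) * Real.exp (z ^ 2 / (4 * angT t)) = 1 := by
    rw [← Real.exp_add, neg_div, neg_add_cancel, Real.exp_zero]
  unfold phiF
  simp only [id, Pi.neg_apply, Pi.pow_apply, Pi.mul_apply]
  generalize (∫ s in (0 : ℝ)..z, f x y s * Real.exp (s ^ 2 / (4 * angT t))) = J
  generalize Real.exp (z ^ 2 / (4 * angT t)) = E at he ⊢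
  generalize Real.exp (-(z ^ 2) / (4 * angT t)) = e at he ⊢
  have : z * f x y z = z * f x y z * (e * E) := by rw [he, mul_one]
  rw [this]
  field_simp
  push_cast
  ring

open scoped ENNReal in
/-- The `L²(μ)` norm of an `ℝ≥0∞`-valued function. -/
def el2 {α : Type*} [MeasurableSpace α] (μ : Measure α) (f : α → ℝ≥0∞) : ℝ≥0∞ :=
  (∫⁻ a, f a ^ 2 ∂μ) ^ (1 / 2 : ℝ)

section el2

open scoped ENNReal

variable {α : Type*} [MeasurableSpace α] {μ ν : Measure α} {f g : α → ℝ≥0∞}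

theorem el2_sq : el2 μ f ^ 2 = ∫⁻ a, f a ^ 2 ∂μ := by
  rw [el2, ← ENNReal.rpow_natCast, ← ENNReal.rpow_mul]
  norm_num

theorem el2_le_iff {c : ℝ≥0∞} : el2 μ f ≤ c ↔ ∫⁻ a, f a ^ 2 ∂μ ≤ c ^ 2 := by
  rw [← el2_sq, ENNReal.pow_le_pow_left_iff two_ne_zero]

theorem el2_mono (h : ∀ᵐ a ∂μ, f a ≤ g a) : el2 μ f ≤ el2 μ g :=
  ENNReal.rpow_le_rpow (lintegral_mono_ae (h.mono fun a ha => by gcongr)) (by norm_num)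

theorem el2_mono_measure (h : μ ≤ ν) : el2 μ f ≤ el2 ν f :=
  ENNReal.rpow_le_rpow (lintegral_mono' h le_rfl) (by norm_num)

theorem el2_const_mul (c : ℝ≥0∞) (hf : Measurable f) :
    el2 μ (fun a => c * f a) = c * el2 μ f := by
  simp only [el2, mul_pow]
  rw [lintegral_const_mul _ (hf.pow_const 2), ENNReal.mul_rpow_of_nonneg _ _ (by norm_num),
    ← ENNReal.rpow_natCast, ← ENNReal.rpow_mul]
  norm_num

theorem el2_add_le (hf : Measurable f) (hg : Measurable g) :
    el2 μ (fun a => f a + g a) ≤ el2 μ f + el2 μ g := by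
  have h := ENNReal.lintegral_Lp_add_le (p := 2) (μ := μ) hf.aemeasurable hg.aemeasurable
    one_le_two
  simpa [el2] using h

theorem lintegral_mul_le_el2 (hf : Measurable f) (hg : Measurable g) :
    ∫⁻ a, f a * g a ∂μ ≤ el2 μ f * el2 μ g := by
  have h := ENNReal.lintegral_mul_le_Lp_mul_Lq μ Real.HolderConjugate.two_two
    hf.aemeasurable hg.aemeasurable
  simpa [el2] using h

end el2

theorem lintegral_ofReal_gaussian_le {b c : ℝ} (hb : 0 < b) (hc : 0 ≤ c)
    (h : 16 ≤ b * c ^ 2 * 4) (w : ℝ) :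
    ∫⁻ z : ℝ, ENNReal.ofReal (Real.exp (-b * (w - z) ^ 2)) ≤ ENNReal.ofReal c := by
  have h0 := integrable_exp_neg_mul_sq hb
  rw [lintegral_sub_left_eq_self (μ := volume)
    (fun z => ENNReal.ofReal (Real.exp (-b * z ^ 2))) w,
    ← ofReal_integral_eq_lintegral_ofReal h0 (ae_of_all _ fun z => (Real.exp_pos _).le),
    integral_gaussian]
  refine ENNReal.ofReal_le_ofReal (Real.sqrt_le_iff.2 ⟨hc, ?_⟩)
  rw [div_le_iff₀ hb]
  nlinarith [Real.pi_lt_four]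

theorem thw_two (t z : ℝ) : thw t 2 z = thw t 1 z * thw t 1 z := by
  rw [thw, thw, ← Real.exp_add]
  ring_nf

theorem continuous_thw (t lam : ℝ) : Continuous (thw t lam) := by
  unfold thw
  fun_prop

section slice

open scoped ENNReal

/-- The weighted `L²` norm of a function on the half line `(0,∞)`, with weight `θ`. -/
def sliceNorm (t : ℝ) (f : ℝ → ℝ) : ℝ≥0∞ :=
  el2 (volume.restrict (Ioi 0)) fun z => ‖thw t 1 z * f z‖ₑ

/-- The operator `φ` on functions of the vertical variable only. -/
def phiSlice (t : ℝ) (f : ℝ → ℝ) (z : ℝ) : ℝ :=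
  Real.exp (-(z ^ 2) / (4 * angT t)) * ∫ s in (0 : ℝ)..z, f s * Real.exp (s ^ 2 / (4 * angT t))

variable {t s : ℝ} {f h k : ℝ → ℝ}

theorem continuous_phiSlice (hf : Continuous f) : Continuous (phiSlice t f) := by
  unfold phiSlice
  fun_prop

theorem measurable_enorm_thw_mul (hf : Continuous f) :
    Measurable fun z => ‖thw t 1 z * f z‖ₑ :=
  ((continuous_thw t 1).mul hf).enorm.measurable

theorem enorm_thw_mul_phiSlice_le (hs : 0 < s) (hst : s ^ 4 = angT t) (hf : Continuous f) {z : ℝ}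
    (hz : 0 ≤ z) :
    ‖thw t 1 z * phiSlice t f z‖ₑ ≤ ENNReal.ofReal (2 * s) * sliceNorm t f := by
  have hT : 0 < angT t := hst ▸ pow_pos hs 4
  set E : ℝ → ℝ := fun r => Real.exp ((r ^ 2 - z ^ 2) / (8 * angT t)) with hE
  have hEc : Continuous E := by fun_prop
  have e1 : thw t 1 z * phiSlice t f z = ∫ r in Ioc 0 z, E r * (thw t 1 r * f r) := by
    rw [← intervalIntegral.integral_of_le hz, phiSlice, ← mul_assoc,
      ← intervalIntegral.integral_const_mul]
    refine intervalIntegral.integral_congr fun r _ => ?_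
    simp only [hE, thw]
    rw [← Real.exp_add, mul_comm (f r), ← mul_assoc, ← mul_assoc, ← Real.exp_add, ← Real.exp_add]
    congr 2
    field_simp
    ring
  rw [e1]
  have h1 : ∫⁻ r in Ioc 0 z, ‖E r‖ₑ ^ 2 ≤ ENNReal.ofReal (2 * s) ^ 2 := by
    have h2 := lintegral_ofReal_gaussian_le (b := 1 / (4 * angT t)) (c := (2 * s) ^ 2)
      (by positivity) (by positivity) (by rw [← hst]; field_simp; norm_num) z
    rw [← ENNReal.ofReal_pow (by positivity)]
    refine le_trans (le_trans ?_
      (lintegral_mono' (Measure.restrict_le_self (s := Ioc 0 z)) le_rfl)) h2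
    refine setLIntegral_mono' measurableSet_Ioc fun r hr => ?_
    rw [Real.enorm_of_nonneg (Real.exp_pos _).le, ← ENNReal.ofReal_pow (Real.exp_pos _).le,
      ← Real.exp_nat_mul]
    refine ENNReal.ofReal_le_ofReal (Real.exp_le_exp.2 ?_)
    rw [← sub_nonneg]
    have : -(1 / (4 * angT t)) * (z - r) ^ 2 - (2 : ℕ) * ((r ^ 2 - z ^ 2) / (8 * angT t)) =
        r * (z - r) / (2 * angT t) := by
      field_simp
      push_cast
      ring
    rw [this]
    exact div_nonneg (mul_nonneg hr.1.le (sub_nonneg.2 hr.2)) (by positivity)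
  calc ‖∫ r in Ioc 0 z, E r * (thw t 1 r * f r)‖ₑ
      ≤ ∫⁻ r in Ioc 0 z, ‖E r‖ₑ * ‖thw t 1 r * f r‖ₑ := by
        refine (enorm_integral_le_lintegral_enorm _).trans_eq ?_
        simp only [enorm_mul]
    _ ≤ el2 (volume.restrict (Ioc 0 z)) (fun r => ‖E r‖ₑ) *
          el2 (volume.restrict (Ioc 0 z)) (fun r => ‖thw t 1 r * f r‖ₑ) :=
        lintegral_mul_le_el2 hEc.enorm.measurable (measurable_enorm_thw_mul hf)
    _ ≤ _ := mul_le_mul' (el2_le_iff.2 h1)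
        (el2_mono_measure (Measure.restrict_mono Ioc_subset_Ioi_self le_rfl))

theorem el2_exp_neg_le (hs : 0 < s) (hst : s ^ 4 = angT t) :
    el2 (volume.restrict (Ioi 0))
      (fun z => ENNReal.ofReal (Real.exp (-(z ^ 2) / (16 * angT t)))) ≤ ENNReal.ofReal (3 * s) := by
  have hT : 0 < angT t := hst ▸ pow_pos hs 4
  rw [el2_le_iff]
  have h2 := lintegral_ofReal_gaussian_le (b := 1 / (8 * angT t)) (c := (3 * s) ^ 2)
    (by positivity) (by positivity) (by rw [← hst]; field_simp; norm_num) 0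
  rw [← ENNReal.ofReal_pow (by positivity)]
  refine le_trans (lintegral_mono' Measure.restrict_le_self fun z => le_of_eq ?_) h2
  rw [← ENNReal.ofReal_pow (Real.exp_pos _).le, ← Real.exp_nat_mul]
  congr 2
  push_cast
  field_simp
  ring

theorem el2_psi_le (hs : 0 < s) (hst : s ^ 4 = angT t) (hf : Continuous f) :
    el2 (volume.restrict (Ioi 0))
      (fun z => ‖(1 - z ^ 2 / (2 * angT t)) * phiSlice t f z + z * f z‖ₑ) ≤
      ENNReal.ofReal (50 * s ^ 2) * sliceNorm t f := by
  have hT : 0 < angT t := hst ▸ pow_pos hs 4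
  set c := ENNReal.ofReal (16 * s) * sliceNorm t f with hc
  set e := fun z : ℝ => ENNReal.ofReal (Real.exp (-(z ^ 2) / (16 * angT t))) with he
  have hem : Measurable e := by fun_prop
  have hpt : ∀ z ∈ Ioi (0 : ℝ), ‖(1 - z ^ 2 / (2 * angT t)) * phiSlice t f z + z * f z‖ₑ ≤
      c * e z + ENNReal.ofReal (2 * s ^ 2) * ‖thw t 1 z * f z‖ₑ := by
    intro z hz
    refine (enorm_add_le _ _).trans (add_le_add ?_ ?_)
    · have h1 := enorm_thw_mul_phiSlice_le hs hst hf (le_of_lt hz)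
      have h2 : ‖(1 - z ^ 2 / (2 * angT t)) * phiSlice t f z‖ₑ ≤
          ENNReal.ofReal (8 * Real.exp (-(z ^ 2) / (16 * angT t))) *
            ‖thw t 1 z * phiSlice t f z‖ₑ := by
        rw [← Real.enorm_of_nonneg (by positivity), ← enorm_mul, ← mul_assoc]
        rw [enorm_mul, enorm_mul]
        gcongr
        rw [Real.enorm_eq_ofReal_abs, Real.enorm_eq_ofReal_abs]
        refine ENNReal.ofReal_le_ofReal (le_trans ?_ (le_abs_self _))
        rw [thw, mul_assoc, ← Real.exp_add]
        have e1 : -(z ^ 2) / (16 * angT t) + 1 * z ^ 2 / (8 * angT t) = z ^ 2 / (16 * angT t) := by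
          field_simp
          ring
        rw [e1]
        have h3 := Real.add_one_le_exp (z ^ 2 / (16 * angT t))
        have h4 : z ^ 2 / (2 * angT t) = 8 * (z ^ 2 / (16 * angT t)) := by field_simp; ring
        have h5 : 0 ≤ z ^ 2 / (16 * angT t) := by positivity
        rw [h4, abs_le]
        constructor <;> linarith
      refine h2.trans ((mul_le_mul_right h1 _).trans_eq ?_)
      rw [hc, he, ENNReal.ofReal_mul (by norm_num), show 16 * s = 8 * (2 * s) by ring,
        ENNReal.ofReal_mul (p := 8) (q := 2 * s) (by norm_num)]
      ring
    · rw [← Real.enorm_of_nonneg (by positivity), ← enorm_mul, ← mul_assoc, enorm_mul,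
        enorm_mul (2 * s ^ 2 * thw t 1 z)]
      gcongr
      rw [Real.enorm_eq_ofReal_abs, Real.enorm_eq_ofReal_abs]
      refine ENNReal.ofReal_le_ofReal (le_trans ?_ (le_abs_self _))
      rw [thw, abs_of_pos hz]
      have h3 := Real.add_one_le_exp (1 * z ^ 2 / (8 * angT t))
      have h4 : z ≤ 2 * s ^ 2 * (1 * z ^ 2 / (8 * angT t) + 1) := by
        rw [← hst]
        have : 2 * s ^ 2 * (1 * z ^ 2 / (8 * s ^ 4) + 1) - z =
            ((z / 2 - s ^ 2) ^ 2 + s ^ 4) / s ^ 2 := by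
          field_simp
          ring
        have : 0 ≤ ((z / 2 - s ^ 2) ^ 2 + s ^ 4) / s ^ 2 := by positivity
        linarith
      exact h4.trans (by gcongr)
  refine (el2_mono (ae_restrict_of_forall_mem measurableSet_Ioi hpt)).trans ?_
  refine (el2_add_le (hem.const_mul c) ((measurable_enorm_thw_mul hf).const_mul _)).trans ?_
  rw [el2_const_mul _ hem, el2_const_mul _ (measurable_enorm_thw_mul hf)]
  refine (add_le_add (mul_le_mul_right (el2_exp_neg_le hs hst) _) le_rfl).trans_eq ?_
  rw [hc, show 50 * s ^ 2 = (16 * s) * (3 * s) + 2 * s ^ 2 by ring,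
    ENNReal.ofReal_add (by positivity) (by positivity),
    ENNReal.ofReal_mul (p := 16 * s) (q := 3 * s) (by positivity),
    sliceNorm]
  ring

theorem lintegral_phi_psi_le (hs : 0 < s) (hst : s ^ 4 = angT t) (hf : Continuous f)
    (hh : Continuous h) (hk : Continuous k) :
    ∫⁻ z in Ioi 0, ‖thw t 2 z * (phiSlice t f z *
      ((1 - z ^ 2 / (2 * angT t)) * phiSlice t h z + z * h z)) * k z‖ₑ ≤
      ENNReal.ofReal (100 * s ^ 3) * (sliceNorm t f * sliceNorm t h * sliceNorm t k) := by
  have hψ : Measurable fun z =>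
      ‖(1 - z ^ 2 / (2 * angT t)) * phiSlice t h z + z * h z‖ₑ := by
    have := continuous_phiSlice (t := t) hh
    exact (by fun_prop : Continuous fun z =>
      (1 - z ^ 2 / (2 * angT t)) * phiSlice t h z + z * h z).enorm.measurable
  calc _ ≤ ∫⁻ z in Ioi 0, (ENNReal.ofReal (2 * s) * sliceNorm t f) *
        (‖(1 - z ^ 2 / (2 * angT t)) * phiSlice t h z + z * h z‖ₑ * ‖thw t 1 z * k z‖ₑ) := by
        refine setLIntegral_mono' measurableSet_Ioi fun z hz => ?_
        refine le_trans (le_of_eq ?_)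
          (mul_le_mul_left (enorm_thw_mul_phiSlice_le hs hst hf (le_of_lt hz)) _)
        rw [thw_two]
        simp only [enorm_mul]
        ring
    _ = _ := lintegral_const_mul _ (hψ.mul (measurable_enorm_thw_mul hk))
    _ ≤ (ENNReal.ofReal (2 * s) * sliceNorm t f) *
          ((ENNReal.ofReal (50 * s ^ 2) * sliceNorm t h) * sliceNorm t k) := by
        refine mul_le_mul_right ((lintegral_mul_le_el2 hψ (measurable_enorm_thw_mul hk)).trans ?_) _
        exact mul_le_mul_left (el2_psi_le hs hst hh) _
    _ = _ := by
        rw [show 100 * s ^ 3 = (2 * s) * (50 * s ^ 2) by ring,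
          ENNReal.ofReal_mul (p := 2 * s) (by positivity)]
        ring

end slice

section sobolev

open scoped ENNReal

variable {α β : Type*} [MeasurableSpace α] [MeasurableSpace β]

theorem el2_el2_eq_prod {μ : Measure α} {ν : Measure β} [SFinite ν] {h : α × β → ℝ≥0∞}
    (hh : Measurable h) :
    el2 μ (fun a => el2 ν fun b => h (a, b)) = el2 (μ.prod ν) h := by
  conv_lhs => rw [el2]
  simp only [el2_sq]
  rw [el2, lintegral_prod _ (hh.pow_const 2).aemeasurable]

theorem el2_el2_swap {μ : Measure α} {ν : Measure β} [SFinite μ] [SFinite ν] {h : α × β → ℝ≥0∞}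
    (hh : Measurable h) :
    el2 μ (fun a => el2 ν fun b => h (a, b)) = el2 ν (fun b => el2 μ fun a => h (a, b)) := by
  conv_lhs => rw [el2]
  conv_rhs => rw [el2]
  simp only [el2_sq]
  rw [lintegral_lintegral_swap (hh.pow_const 2).aemeasurable]

theorem measurable_el2_right {ν : Measure β} [SFinite ν] {h : α × β → ℝ≥0∞} (hh : Measurable h) :
    Measurable fun a => el2 ν fun b => h (a, b) :=
  ((hh.pow_const 2).lintegral_prod_right').pow_const _

theorem setLIntegral_Icc_le_el2 {f : ℝ → ℝ≥0∞} (hf : Measurable f) (x : ℝ) :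
    ∫⁻ s in Icc x (x + 1), f s ≤ el2 volume f := by
  have h := lintegral_mul_le_el2 (μ := volume.restrict (Icc x (x + 1)))
    (measurable_const (a := (1 : ℝ≥0∞))) hf
  simp only [one_mul] at h
  refine h.trans ?_
  have h1 : el2 (volume.restrict (Icc x (x + 1))) (fun _ => (1 : ℝ≥0∞)) = 1 := by
    simp [el2]
  rw [h1, one_mul]
  exact el2_mono_measure Measure.restrict_le_self

theorem enorm_le_el2_add_el2_deriv {f f' : ℝ → ℝ} (hd : ∀ x, HasDerivAt f (f' x) x)
    (hf' : Continuous f') (x : ℝ) :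
    ‖f x‖ₑ ≤ el2 volume (fun s => ‖f s‖ₑ) + el2 volume (fun s => ‖f' s‖ₑ) := by
  have hf : Continuous f := continuous_iff_continuousAt.2 fun x => (hd x).continuousAt
  have hpt : ∀ s ∈ Icc x (x + 1),
      ‖f x‖ₑ ≤ ‖f s‖ₑ + ∫⁻ r in Icc x (x + 1), ‖f' r‖ₑ := by
    intro s hs
    have h1 : f x = f s - ∫ r in x..s, f' r := by
      rw [intervalIntegral.integral_eq_sub_of_hasDerivAt (fun r _ => hd r)
        (hf'.intervalIntegrable _ _)]
      ring
    rw [h1]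
    refine (enorm_sub_le).trans (add_le_add le_rfl ?_)
    rw [intervalIntegral.integral_of_le hs.1]
    refine (enorm_integral_le_lintegral_enorm _).trans ?_
    refine lintegral_mono' (Measure.restrict_mono ?_ le_rfl) le_rfl
    exact fun r hr => ⟨hr.1.le, hr.2.trans hs.2⟩
  have h2 := setLIntegral_mono' (μ := volume) measurableSet_Icc hpt
  rw [lintegral_add_right _ measurable_const] at h2
  simp only [lintegral_const, Measure.restrict_apply MeasurableSet.univ, univ_inter,
    Real.volume_Icc, add_sub_cancel_left, ENNReal.ofReal_one, mul_one] at h2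
  exact h2.trans (add_le_add (setLIntegral_Icc_le_el2 hf.enorm.measurable x)
    (setLIntegral_Icc_le_el2 hf'.enorm.measurable x))

theorem enorm_weight_mul_le_el2 {w w' f f' : ℝ → ℝ} (m : ℕ) (hw : ∀ x, HasDerivAt w (w' x) x)
    (hwc : Continuous w') (hww : ∀ x, |w' x| ≤ m * w x) (hd : ∀ x, HasDerivAt f (f' x) x)
    (hf' : Continuous f') (x : ℝ) :
    ‖w x * f x‖ₑ ≤ (m + 1) * el2 volume (fun s => ‖w s * f s‖ₑ) +
      el2 volume (fun s => ‖w s * f' s‖ₑ) := by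
  have hf : Continuous f := continuous_iff_continuousAt.2 fun x => (hd x).continuousAt
  have hwc0 : Continuous w := continuous_iff_continuousAt.2 fun x => (hw x).continuousAt
  have m1 : Measurable fun s => ‖w s * f s‖ₑ := (hwc0.mul hf).enorm.measurable
  have m2 : Measurable fun s => ‖w s * f' s‖ₑ := (hwc0.mul hf').enorm.measurable
  refine (enorm_le_el2_add_el2_deriv (fun x => (hw x).mul (hd x))
    ((hwc.mul hf).add (hwc0.mul hf')) x).trans ?_
  rw [add_mul, one_mul, add_comm (_ * _), add_assoc]
  refine add_le_add le_rfl ?_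
  rw [← el2_const_mul _ m1]
  refine le_trans (el2_mono (ae_of_all _ fun s => ?_)) (el2_add_le (m1.const_mul _) m2)
  refine (enorm_add_le _ _).trans (add_le_add ?_ le_rfl)
  rw [enorm_mul, enorm_mul, ← mul_assoc]
  gcongr
  rw [Real.enorm_eq_ofReal_abs, Real.enorm_eq_ofReal_abs, ← ENNReal.ofReal_natCast m,
    ← ENNReal.ofReal_mul (by positivity)]
  refine ENNReal.ofReal_le_ofReal ((hww s).trans ?_)
  gcongr
  exact le_abs_self _

theorem one_le_angR (x y : ℝ) : 1 ≤ angR x y :=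
  Real.one_le_sqrt.2 (by nlinarith [sq_nonneg x, sq_nonneg y])

theorem abs_left_le_angR (x y : ℝ) : |x| ≤ angR x y :=
  Real.abs_le_sqrt (by nlinarith [sq_nonneg y])

theorem angR_comm (x y : ℝ) : angR x y = angR y x := by
  rw [angR, angR, add_comm (x ^ 2)]

theorem abs_right_le_angR (x y : ℝ) : |y| ≤ angR x y :=
  angR_comm y x ▸ abs_left_le_angR y x

theorem continuous_angR : Continuous fun p : ℝ × ℝ => angR p.1 p.2 := by
  unfold angR
  fun_prop

theorem hasDerivAt_angR_pow (k : ℕ) (x y : ℝ) :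
    HasDerivAt (fun x => angR x y ^ k) (k * angR x y ^ (k - 1) * (x / angR x y)) x := by
  have h0 : x ^ 2 + y ^ 2 + 1 ≠ 0 := by positivity
  have h := ((((hasDerivAt_id x).pow 2).add_const (y ^ 2)).add_const 1).sqrt h0
  refine (h.pow k).congr_deriv ?_
  simp only [angR, id, Pi.pow_apply]
  congr 1
  have : √(x ^ 2 + y ^ 2 + 1) ≠ 0 := by positivity
  field_simp
  push_cast
  ring

theorem abs_deriv_angR_pow_le (k : ℕ) (x y : ℝ) :
    |k * angR x y ^ (k - 1) * (x / angR x y)| ≤ k * angR x y ^ k := by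
  have h1 := one_le_angR x y
  have h2 := abs_left_le_angR x y
  rw [abs_mul, abs_div, abs_of_nonneg (a := angR x y) (by linarith),
    abs_of_nonneg (a := _ * _) (by positivity)]
  calc k * angR x y ^ (k - 1) * (|x| / angR x y) ≤ k * angR x y ^ k * 1 := by
        gcongr
        · omega
        · exact (div_le_one (by linarith)).2 h2
    _ = _ := mul_one _

/-- The weighted `L²` norm in the vertical variable of `θ ⟨r⟩ᵏ ∂^{(a,b)}_h g`. -/
def jetNorm (t : ℝ) (F : ℕ → ℕ → ℝ → ℝ → ℝ → ℝ) (k a b : ℕ) (x y : ℝ) : ℝ≥0∞ :=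
  el2 (volume.restrict (Ioi 0)) fun z => ‖angR x y ^ k * (thw t 1 z * F a b x y z)‖ₑ

variable {F : ℕ → ℕ → ℝ → ℝ → ℝ → ℝ} {t : ℝ}

theorem HJet.measurable_enorm_weight (hF : HJet F) (k a b : ℕ) :
    Measurable fun p : ℝ × ℝ × ℝ =>
      ‖angR p.1 p.2.1 ^ k * (thw t 1 p.2.2 * F a b p.1 p.2.1 p.2.2)‖ₑ := by
  have h1 : Continuous fun p : ℝ × ℝ × ℝ => angR p.1 p.2.1 :=
    continuous_angR.comp (f := fun p : ℝ × ℝ × ℝ => (p.1, p.2.1)) (by fun_prop)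
  have h2 : Continuous fun p : ℝ × ℝ × ℝ => thw t 1 p.2.2 :=
    (continuous_thw t 1).comp (by fun_prop)
  exact ((h1.pow k).mul (h2.mul (hF.cont a b))).enorm.measurable

theorem HJet.measurable_jetNorm (hF : HJet F) (k a b : ℕ) :
    Measurable fun p : ℝ × ℝ => jetNorm t F k a b p.1 p.2 :=
  measurable_el2_right (h := fun q : (ℝ × ℝ) × ℝ =>
    ‖angR q.1.1 q.1.2 ^ k * (thw t 1 q.2 * F a b q.1.1 q.1.2 q.2)‖ₑ)
    ((hF.measurable_enorm_weight k a b).comp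
      (f := fun q : (ℝ × ℝ) × ℝ => (q.1.1, q.1.2, q.2)) (by fun_prop))

theorem jetNorm_mono {k l : ℕ} (h : k ≤ l) (a b : ℕ) (x y : ℝ) :
    jetNorm t F k a b x y ≤ jetNorm t F l a b x y := by
  refine el2_mono (ae_of_all _ fun z => ?_)
  have h1 := one_le_angR x y
  have h0 (m : ℕ) : 0 ≤ angR x y ^ m := pow_nonneg (zero_le_one.trans h1) m
  rw [enorm_mul, enorm_mul (_ ^ l), Real.enorm_of_nonneg (h0 k), Real.enorm_of_nonneg (h0 l)]
  gcongr

theorem HJet.jetNorm_le_dx (hF : HJet F) (k a b : ℕ) (x y : ℝ) :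
    jetNorm t F k a b x y ≤ (k + 1) * el2 volume (fun s => jetNorm t F k a b s y) +
      el2 volume (fun s => jetNorm t F k (a + 1) b s y) := by
  have hm (a : ℕ) : Measurable fun q : ℝ × ℝ =>
      ‖angR q.2 y ^ k * (thw t 1 q.1 * F a b q.2 y q.1)‖ₑ :=
    (hF.measurable_enorm_weight k a b).comp
      (f := fun q : ℝ × ℝ => (q.2, y, q.1)) (by fun_prop)
  have hpt (z : ℝ) := enorm_weight_mul_le_el2 k (w := fun x => angR x y ^ k)
    (fun x => hasDerivAt_angR_pow k x y)
    (by
      have : Continuous fun x => angR x y := continuous_angR.comp (f := fun x => (x, y))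
        (by fun_prop)
      refine ((this.pow _).const_mul _).mul (continuous_id.div this fun x => ?_)
      have := one_le_angR x y
      positivity)
    (fun x => abs_deriv_angR_pow_le k x y)
    (fun x => (hF.dx a b x y z).const_mul (thw t 1 z))
    (((hF.cont (a + 1) b).comp (f := fun x => (x, y, z)) (by fun_prop)).const_mul _) x
  refine (el2_mono (ae_of_all _ hpt)).trans ?_
  refine (el2_add_le ((measurable_el2_right (hm a)).const_mul _)
    (measurable_el2_right (hm (a + 1)))).trans ?_
  rw [el2_const_mul _ (measurable_el2_right (hm a)), el2_el2_swap (hm a),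
    el2_el2_swap (hm (a + 1))]
  rfl

theorem HJet.jetNorm_le_dy (hF : HJet F) (k a b : ℕ) (x y : ℝ) :
    jetNorm t F k a b x y ≤ (k + 1) * el2 volume (fun s => jetNorm t F k a b x s) +
      el2 volume (fun s => jetNorm t F k a (b + 1) x s) := by
  have h : HJet fun a b x y z => F b a y x z :=
    ⟨fun a b => (hF.cont b a).comp (f := fun p : ℝ × ℝ × ℝ => (p.2.1, p.1, p.2.2)) (by fun_prop),
      fun a b x y z => hF.dy b a y x z, fun a b x y z => hF.dx b a y x z⟩
  have := h.jetNorm_le_dx (t := t) k b a y x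
  simpa only [jetNorm, angR_comm _ x] using this

/-- The `L²` norm of `θ ⟨r⟩^{a+b} ∂^{(a,b)}_h g` over `ℝ² × (0,∞)`. -/
def jetL2 (t : ℝ) (F : ℕ → ℕ → ℝ → ℝ → ℝ → ℝ) (a b : ℕ) : ℝ≥0∞ :=
  el2 volume fun p : ℝ × ℝ => jetNorm t F (a + b) a b p.1 p.2

theorem HJet.jetNorm_le_jetL2 (hF : HJet F) (a b : ℕ) (x y : ℝ) :
    jetNorm t F (a + b) a b x y ≤ (a + b + 1) * ((a + b + 1) * jetL2 t F a b + jetL2 t F a (b + 1))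
      + ((a + b + 1) * jetL2 t F (a + 1) b + jetL2 t F (a + 1) (b + 1)) := by
  have key : ∀ a' b', a + b ≤ a' + b' →
      el2 volume (fun s => el2 volume fun r => jetNorm t F (a + b) a' b' s r) ≤
        jetL2 t F a' b' := by
    intro a' b' h
    rw [el2_el2_eq_prod (hF.measurable_jetNorm (t := t) (a + b) a' b')]
    exact el2_mono (ae_of_all _ fun p => jetNorm_mono h _ _ _ _)
  have step : ∀ a', a ≤ a' → el2 volume (fun s => jetNorm t F (a + b) a' b s y) ≤
      (a + b + 1) * jetL2 t F a' b + jetL2 t F a' (b + 1) := by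
    intro a' h
    have hm (b' : ℕ) : Measurable fun s => el2 volume fun r => jetNorm t F (a + b) a' b' s r :=
      measurable_el2_right (hF.measurable_jetNorm (t := t) (a + b) a' b')
    refine (el2_mono (ae_of_all _ fun s => hF.jetNorm_le_dy (t := t) (a + b) a' b s y)).trans ?_
    refine (el2_add_le ((hm b).const_mul _) (hm (b + 1))).trans ?_
    rw [el2_const_mul _ (hm b)]
    push_cast
    gcongr
    · exact key a' b (by omega)
    · exact key a' (b + 1) (by omega)
  refine (hF.jetNorm_le_dx (t := t) (a + b) a b x y).trans ?_
  push_cast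
  gcongr
  · exact step a le_rfl
  · exact step (a + 1) (by omega)

end sobolev

section trilinear

open scoped ENNReal

variable {F G H : ℕ → ℕ → ℝ → ℝ → ℝ → ℝ} {t s : ℝ}

/-- The horizontal derivatives of `-(x ∂_x + y ∂_y) f - 2 f`, in terms of those of `f`. -/
def uzJet (F : ℕ → ℕ → ℝ → ℝ → ℝ → ℝ) : ℕ → ℕ → ℝ → ℝ → ℝ → ℝ := fun a b x y z =>
  -(x * F (a + 1) b x y z + y * F a (b + 1) x y z) - (a + b + 2) * F a b x y z

/-- The horizontal derivatives of `∂_z (z φ)`, in terms of those of `g`. -/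
def psiJet (t : ℝ) (F : ℕ → ℕ → ℝ → ℝ → ℝ → ℝ) : ℕ → ℕ → ℝ → ℝ → ℝ → ℝ := fun a b x y z =>
  (1 - z ^ 2 / (2 * angT t)) * phiF t (F a b) x y z + z * F a b x y z

theorem HJet.uzJet (hF : HJet F) : HJet (uzJet F) := hF.uz

theorem HJet.psiJet (hF : HJet F) (t : ℝ) : HJet (psiJet t F) :=
  ((hF.phiF t).vertical_mul (c := fun z => 1 - z ^ 2 / (2 * angT t)) (by fun_prop)).add
    (hF.vertical_mul (c := fun z => z) continuous_id)

theorem HJet.continuous_slice (hF : HJet F) (a b : ℕ) (x y : ℝ) : Continuous (F a b x y) :=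
  (hF.cont a b).comp (f := fun z => (x, y, z)) (by fun_prop)

theorem HJet.uzv_eq (hF : HJet F) (t : ℝ) :
    uzv t (F 0 0) = _root_.phiF t (_root_.uzJet F 0 0) := by
  have hx : pdx (_root_.phiF t (F 0 0)) = _root_.phiF t (F 1 0) := (hF.phiF t).pdh_eq 1 0
  have hy : pdy (_root_.phiF t (F 0 0)) = _root_.phiF t (F 0 1) := (hF.phiF t).pdh_eq 0 1
  funext x y z
  have hi (a b : ℕ) : IntervalIntegrable
      (fun r => F a b x y r * Real.exp (r ^ 2 / (4 * angT t))) volume 0 z :=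
    ((hF.continuous_slice a b x y).mul (by fun_prop)).intervalIntegrable _ _
  rw [uzv, rdr, hx, hy]
  have h : (∫ r in (0 : ℝ)..z, _root_.uzJet F 0 0 x y r * Real.exp (r ^ 2 / (4 * angT t))) =
      -(x * (∫ r in (0 : ℝ)..z, F 1 0 x y r * Real.exp (r ^ 2 / (4 * angT t))) +
        y * ∫ r in (0 : ℝ)..z, F 0 1 x y r * Real.exp (r ^ 2 / (4 * angT t))) -
      2 * ∫ r in (0 : ℝ)..z, F 0 0 x y r * Real.exp (r ^ 2 / (4 * angT t)) := by
    rw [← intervalIntegral.integral_const_mul, ← intervalIntegral.integral_const_mul,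
      ← intervalIntegral.integral_const_mul,
      ← intervalIntegral.integral_add ((hi 1 0).const_mul x) ((hi 0 1).const_mul y),
      ← intervalIntegral.integral_neg]
    refine Eq.trans ?_ (intervalIntegral.integral_sub
      (((hi 1 0).const_mul x).add ((hi 0 1).const_mul y)).neg ((hi 0 0).const_mul 2))
    refine intervalIntegral.integral_congr fun r _ => ?_
    simp only [_root_.uzJet]
    push_cast
    ring
  simp only [_root_.phiF]
  rw [h]
  ring

theorem jetNorm_eq (k a b : ℕ) (x y : ℝ) (hF : HJet F) :
    jetNorm t F k a b x y = ‖angR x y ^ k‖ₑ * sliceNorm t (F a b x y) := by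
  simp only [jetNorm, enorm_mul (angR x y ^ k)]
  exact el2_const_mul _ (measurable_enorm_thw_mul (hF.continuous_slice a b x y))

theorem jetNorm_uzJet_le (hF : HJet F) (a b : ℕ) (x y : ℝ) :
    jetNorm t (uzJet F) (a + b) a b x y ≤
      jetNorm t F (a + 1 + b) (a + 1) b x y + jetNorm t F (a + (b + 1)) a (b + 1) x y +
        (a + b + 2) * jetNorm t F (a + b) a b x y := by
  have hm (k a b : ℕ) : Measurable fun z => ‖angR x y ^ k * (thw t 1 z * F a b x y z)‖ₑ :=
    (continuous_const.mul ((continuous_thw t 1).mul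
      (hF.continuous_slice a b x y))).enorm.measurable
  refine le_trans (el2_mono (ae_of_all _ fun z => ?_)) ((el2_add_le
    ((hm (a + 1 + b) (a + 1) b).add (hm (a + (b + 1)) a (b + 1)))
    ((hm (a + b) a b).const_mul ((a : ℝ≥0∞) + b + 2))).trans
    (add_le_add (el2_add_le (hm _ _ _) (hm _ _ _)) (el2_const_mul _ (hm _ _ _)).le))
  have h1 := one_le_angR x y
  have hR : 0 ≤ angR x y := zero_le_one.trans h1
  have e : angR x y ^ (a + b) * (thw t 1 z * uzJet F a b x y z) =
      -(x * (angR x y ^ (a + b) * (thw t 1 z * F (a + 1) b x y z)) +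
        y * (angR x y ^ (a + b) * (thw t 1 z * F a (b + 1) x y z))) -
      ((a + b + 2 : ℕ) : ℝ) * (angR x y ^ (a + b) * (thw t 1 z * F a b x y z)) := by
    simp only [uzJet]
    push_cast
    ring
  have hk {w : ℝ} (hw : |w| ≤ angR x y) (v : ℝ) (k : ℕ) (hk : k = a + b + 1) :
      ‖w * (angR x y ^ (a + b) * v)‖ₑ ≤ ‖angR x y ^ k * v‖ₑ := by
    rw [hk, pow_succ', mul_assoc, enorm_mul, enorm_mul (angR x y)]
    gcongr
    rw [Real.enorm_eq_ofReal_abs, Real.enorm_eq_ofReal_abs, abs_of_nonneg hR]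
    exact ENNReal.ofReal_le_ofReal hw
  rw [e]
  refine enorm_sub_le.trans (add_le_add ?_ ?_)
  · rw [enorm_neg]
    exact (enorm_add_le _ _).trans (add_le_add (hk (abs_left_le_angR x y) _ _ (by ring))
      (hk (abs_right_le_angR x y) _ _ (by ring)))
  · rw [enorm_mul, Real.enorm_natCast]
    push_cast
    rfl

theorem jetL2_uzJet_le (hF : HJet F) (a b : ℕ) :
    jetL2 t (uzJet F) a b ≤
      jetL2 t F (a + 1) b + jetL2 t F a (b + 1) + (a + b + 2) * jetL2 t F a b := by
  have hm (k a b : ℕ) := hF.measurable_jetNorm (t := t) k a b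
  have h1 := el2_mono (μ := (volume : Measure (ℝ × ℝ)))
    (ae_of_all _ fun p => jetNorm_uzJet_le (t := t) hF a b p.1 p.2)
  have h2 := el2_add_le (μ := (volume : Measure (ℝ × ℝ)))
    ((hm (a + 1 + b) (a + 1) b).add (hm (a + (b + 1)) a (b + 1)))
    ((hm (a + b) a b).const_mul ((a : ℝ≥0∞) + b + 2))
  refine h1.trans (h2.trans (add_le_add ?_ ?_))
  · exact el2_add_le (hm (a + 1 + b) (a + 1) b) (hm (a + (b + 1)) a (b + 1))
  · exact (el2_const_mul _ (hm (a + b) a b)).le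

theorem lintegral_jet_mul_le (hs : 0 < s) (hst : s ^ 4 = angT t) (hF : HJet F) (hG : HJet G)
    (hH : HJet H) {i j i' j' a b : ℕ} (ha : i + i' = a) (hb : j + j' = b) (x y : ℝ) :
    ∫⁻ z in Ioi 0, ‖thw t 2 z * angR x y ^ (2 * (a + b)) *
      (phiF t (F i j) x y z * psiJet t G i' j' x y z) * H a b x y z‖ₑ ≤
    ENNReal.ofReal (100 * s ^ 3) * (jetNorm t F (i + j) i j x y * jetNorm t G (i' + j') i' j' x y *
      jetNorm t H (a + b) a b x y) := by
  have h := lintegral_phi_psi_le hs hst (hF.continuous_slice i j x y)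
    (hG.continuous_slice i' j' x y) (hH.continuous_slice a b x y)
  have hc : angR x y ^ (2 * (a + b)) =
      angR x y ^ (i + j) * angR x y ^ (i' + j') * angR x y ^ (a + b) := by
    subst ha hb
    ring
  have e (z : ℝ) : ‖thw t 2 z * angR x y ^ (2 * (a + b)) *
      (phiF t (F i j) x y z * psiJet t G i' j' x y z) * H a b x y z‖ₑ =
      ‖angR x y ^ (2 * (a + b))‖ₑ * ‖thw t 2 z * (phiSlice t (F i j x y) z *
      ((1 - z ^ 2 / (2 * angT t)) * phiSlice t (G i' j' x y) z + z * G i' j' x y z)) *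
        H a b x y z‖ₑ := by
    rw [← enorm_mul]
    congr 1
    simp only [psiJet, phiF, phiSlice]
    ring
  simp only [e]
  rw [lintegral_const_mul' _ _ enorm_ne_top, jetNorm_eq _ _ _ _ _ hF, jetNorm_eq _ _ _ _ _ hG,
    jetNorm_eq _ _ _ _ _ hH, hc, enorm_mul, enorm_mul]
  calc _ ≤ _ := mul_le_mul_right h _
    _ = _ := by ring

end trilinear

section assembly

open scoped ENNReal

variable {F G H : ℕ → ℕ → ℝ → ℝ → ℝ → ℝ} {t s : ℝ}

/-- The bound for the supremum over `(x, y)` of `jetNorm` provided by the Sobolev embedding. -/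
def jetSup (t : ℝ) (F : ℕ → ℕ → ℝ → ℝ → ℝ → ℝ) (a b : ℕ) : ℝ≥0∞ :=
  (a + b + 1) * ((a + b + 1) * jetL2 t F a b + jetL2 t F a (b + 1)) +
    ((a + b + 1) * jetL2 t F (a + 1) b + jetL2 t F (a + 1) (b + 1))

theorem jetNorm_uzJet_le_jetSup (hF : HJet F) (a b : ℕ) (x y : ℝ) :
    jetNorm t (uzJet F) (a + b) a b x y ≤
      jetSup t F (a + 1) b + jetSup t F a (b + 1) + (a + b + 2) * jetSup t F a b :=
  (jetNorm_uzJet_le hF a b x y).trans (add_le_add (add_le_add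
    (hF.jetNorm_le_jetL2 (a + 1) b x y) (hF.jetNorm_le_jetL2 a (b + 1) x y))
    (mul_le_mul_right (hF.jetNorm_le_jetL2 a b x y) _))

theorem lintegral_jetNorm_le_left {i j i' j' a b : ℕ} (hG : HJet G) (hH : HJet H) {c : ℝ≥0∞}
    (hc : ∀ x y, jetNorm t F (i + j) i j x y ≤ c) :
    ∫⁻ p : ℝ × ℝ, jetNorm t F (i + j) i j p.1 p.2 * jetNorm t G (i' + j') i' j' p.1 p.2 *
      jetNorm t H (a + b) a b p.1 p.2 ≤ c * jetL2 t G i' j' * jetL2 t H a b := by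
  have m1 := hG.measurable_jetNorm (t := t) (i' + j') i' j'
  have m2 := hH.measurable_jetNorm (t := t) (a + b) a b
  calc _ ≤ ∫⁻ p : ℝ × ℝ, c * (jetNorm t G (i' + j') i' j' p.1 p.2 *
        jetNorm t H (a + b) a b p.1 p.2) := by
        refine lintegral_mono fun p => ?_
        rw [mul_assoc]
        exact mul_le_mul_left (hc _ _) _
    _ = c * ∫⁻ p : ℝ × ℝ, (jetNorm t G (i' + j') i' j' p.1 p.2 *
        jetNorm t H (a + b) a b p.1 p.2) := lintegral_const_mul _ (m1.mul m2)
    _ ≤ _ := by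
        rw [mul_assoc]
        exact mul_le_mul_right (lintegral_mul_le_el2 m1 m2) _

theorem lintegral_jetNorm_le_right {i j i' j' a b : ℕ} (hF : HJet F) (hH : HJet H) {c : ℝ≥0∞}
    (hc : ∀ x y, jetNorm t G (i' + j') i' j' x y ≤ c) :
    ∫⁻ p : ℝ × ℝ, jetNorm t F (i + j) i j p.1 p.2 * jetNorm t G (i' + j') i' j' p.1 p.2 *
      jetNorm t H (a + b) a b p.1 p.2 ≤ jetL2 t F i j * c * jetL2 t H a b := by
  rw [mul_comm (jetL2 t F i j)]
  refine le_trans (le_of_eq ?_) (lintegral_jetNorm_le_left (i := i') (j := j') hF hH hc)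
  exact lintegral_congr fun p => by rw [mul_comm (jetNorm t F _ _ _ _ _)]

theorem enorm_trip_le (f : ℝ → ℝ → ℝ → ℝ) :
    ‖trip f‖ₑ ≤ ∫⁻ x, ∫⁻ y, ∫⁻ z in Ioi 0, ‖f x y z‖ₑ :=
  (enorm_integral_le_lintegral_enorm _).trans (lintegral_mono fun _ =>
    (enorm_integral_le_lintegral_enorm _).trans (lintegral_mono fun _ =>
      enorm_integral_le_lintegral_enorm _))

theorem pdh_uzv_mul_pdz (hG : HJet G) (ht : 0 < angT t) (a b : ℕ) (x y z : ℝ) :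
    pdh a b (fun x y z => uzv t (G 0 0) x y z *
      pdz (fun x y w => w * phiF t (G 0 0) x y w) x y z) x y z =
    ∑ p ∈ Finset.HasAntidiagonal.antidiagonal a, ∑ q ∈ Finset.HasAntidiagonal.antidiagonal b,
      (a.choose p.1 : ℝ) * (b.choose q.1 : ℝ) *
        (phiF t (uzJet G p.1 q.1) x y z * psiJet t G p.2 q.2 x y z) := by
  have h := ((hG.uzJet.phiF t).mul (hG.psiJet t)).pdh_eq a b
  rw [← congrFun (congrFun (congrFun h x) y) z]
  congr 1
  funext x y z
  simp [hG.uzv_eq, pdz_mul_phiF (hG.cont 0 0) ht, psiJet]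

theorem enorm_trip_uzv_mul_pdz_le (hs : 0 < s) (hst : s ^ 4 = angT t) (hG : HJet G) (a b : ℕ) :
    ‖trip fun x y z => thw t 2 z * angR x y ^ (2 * (a + b)) *
      pdh a b (fun x y z => uzv t (G 0 0) x y z *
        pdz (fun x y w => w * phiF t (G 0 0) x y w) x y z) x y z * G a b x y z‖ₑ ≤
    ∑ p ∈ Finset.HasAntidiagonal.antidiagonal a, ∑ q ∈ Finset.HasAntidiagonal.antidiagonal b,
      (a.choose p.1 : ℝ≥0∞) * (b.choose q.1 : ℝ≥0∞) * (ENNReal.ofReal (100 * s ^ 3) *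
        ∫⁻ r : ℝ × ℝ, jetNorm t (uzJet G) (p.1 + q.1) p.1 q.1 r.1 r.2 *
          jetNorm t G (p.2 + q.2) p.2 q.2 r.1 r.2 * jetNorm t G (a + b) a b r.1 r.2) := by
  have hT : 0 < angT t := hst ▸ pow_pos hs 4
  set S := Finset.HasAntidiagonal.antidiagonal a ×ˢ Finset.HasAntidiagonal.antidiagonal b with hS
  set N : (ℕ × ℕ) × (ℕ × ℕ) → ℝ × ℝ → ℝ≥0∞ := fun m r =>
    jetNorm t (uzJet G) (m.1.1 + m.2.1) m.1.1 m.2.1 r.1 r.2 *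
      jetNorm t G (m.1.2 + m.2.2) m.1.2 m.2.2 r.1 r.2 * jetNorm t G (a + b) a b r.1 r.2 with hN
  have mN (m) : Measurable (N m) :=
    ((hG.uzJet.measurable_jetNorm _ _ _).mul (hG.measurable_jetNorm _ _ _)).mul
      (hG.measurable_jetNorm _ _ _)
  set c : (ℕ × ℕ) × (ℕ × ℕ) → ℝ≥0∞ := fun m => (a.choose m.1.1 : ℝ≥0∞) * (b.choose m.2.1 : ℝ≥0∞)
    with hc
  have hslice (x y : ℝ) : ∫⁻ z in Ioi 0, ‖thw t 2 z * angR x y ^ (2 * (a + b)) *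
      pdh a b (fun x y z => uzv t (G 0 0) x y z *
        pdz (fun x y w => w * phiF t (G 0 0) x y w) x y z) x y z * G a b x y z‖ₑ ≤
      ∑ m ∈ S, c m * (ENNReal.ofReal (100 * s ^ 3) * N m (x, y)) := by
    set f : (ℕ × ℕ) × (ℕ × ℕ) → ℝ → ℝ := fun m z => thw t 2 z * angR x y ^ (2 * (a + b)) *
      (phiF t (uzJet G m.1.1 m.2.1) x y z * psiJet t G m.1.2 m.2.2 x y z) * G a b x y z with hf
    have mf (m) : Measurable fun z => ‖f m z‖ₑ :=
      ((((continuous_thw t 2).mul continuous_const).mul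
        (((hG.uzJet.phiF t).continuous_slice _ _ x y).mul
          ((hG.psiJet t).continuous_slice _ _ x y))).mul
        (hG.continuous_slice a b x y)).enorm.measurable
    calc _ ≤ ∫⁻ z in Ioi 0, ∑ m ∈ S, c m * ‖f m z‖ₑ := by
          refine lintegral_mono fun z => ?_
          simp only [pdh_uzv_mul_pdz hG hT]
          rw [← Finset.sum_product', Finset.mul_sum, Finset.sum_mul]
          refine (enorm_sum_le _ _).trans (Finset.sum_le_sum fun m _ => le_of_eq ?_)
          simp only [hc, hf]
          rw [← Real.enorm_natCast (a.choose _), ← Real.enorm_natCast (b.choose _), ← enorm_mul,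
            ← enorm_mul]
          congr 1
          ring
      _ = ∑ m ∈ S, c m * ∫⁻ z in Ioi 0, ‖f m z‖ₑ := by
          rw [lintegral_finsetSum _ fun m _ => (mf m).const_mul _]
          exact Finset.sum_congr rfl fun m _ => lintegral_const_mul _ (mf m)
      _ ≤ _ := by
          refine Finset.sum_le_sum fun m hm => mul_le_mul_right ?_ _
          rw [hS, Finset.mem_product, Finset.HasAntidiagonal.mem_antidiagonal,
            Finset.HasAntidiagonal.mem_antidiagonal] at hm
          exact lintegral_jet_mul_le hs hst hG.uzJet hG hG hm.1 hm.2 x y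
  calc _ ≤ ∫⁻ x, ∫⁻ y, ∑ m ∈ S, c m * (ENNReal.ofReal (100 * s ^ 3) * N m (x, y)) :=
        (enorm_trip_le _).trans (lintegral_mono fun x => lintegral_mono fun y => hslice x y)
    _ = ∫⁻ r : ℝ × ℝ, ∑ m ∈ S, c m * (ENNReal.ofReal (100 * s ^ 3) * N m r) := by
        rw [Measure.volume_eq_prod, lintegral_prod]
        exact (Finset.measurable_fun_sum _ fun m _ =>
          ((mN m).const_mul _).const_mul _).aemeasurable
    _ = ∑ m ∈ S, c m * (ENNReal.ofReal (100 * s ^ 3) * ∫⁻ r, N m r) := by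
        rw [lintegral_finsetSum _ fun m _ => ((mN m).const_mul _).const_mul _]
        refine Finset.sum_congr rfl fun m _ => ?_
        rw [lintegral_const_mul _ ((mN m).const_mul _), lintegral_const_mul _ (mN m)]
    _ = _ := Finset.sum_product _ _ _

theorem L2w_nonneg (t lam : ℝ) (n : ℕ) (f : ℝ → ℝ → ℝ → ℝ) : 0 ≤ L2w t lam n f :=
  Real.sqrt_nonneg _

theorem jetL2_eq_ofReal {g : ℝ → ℝ → ℝ → ℝ} (hg : HJet fun a b => pdh a b g) (h : L2cond t g)
    (a b : ℕ) :
    jetL2 t (fun a b => pdh a b g) a b = ENNReal.ofReal (L2w t 1 (a + b) (pdh a b g)) := by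
  set f : ℝ × ℝ × ℝ → ℝ := fun p =>
    (thw t 1 p.2.2 * angR p.1 p.2.1 ^ (a + b) * pdh a b g p.1 p.2.1 p.2.2) ^ 2 with hf
  have hmeas : (volume.restrict {p : ℝ × ℝ × ℝ | 0 < p.2.2}) =
      (volume : Measure ℝ).prod ((volume : Measure ℝ).prod (volume.restrict (Ioi 0))) := by
    have h1 := Measure.prod_restrict (μ := (volume : Measure ℝ)) (ν := (volume : Measure ℝ))
      univ (Ioi 0)
    have h2 := Measure.prod_restrict (μ := (volume : Measure ℝ))
      (ν := (volume : Measure ℝ).prod (volume : Measure ℝ)) univ (univ ×ˢ Ioi 0)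
    rw [Measure.restrict_univ] at h1 h2
    rw [h1, h2, Measure.volume_eq_prod, Measure.volume_eq_prod]
    congr 1
    ext p
    simp
  have hi : Integrable f _ := h a b
  rw [hmeas] at hi
  have h_eq : ∫ x, ∫ y, ∫ z in Ioi 0, f (x, y, z) =
      ∫ p, f p ∂((volume : Measure ℝ).prod ((volume : Measure ℝ).prod (volume.restrict (Ioi 0)))) := by
    rw [integral_prod _ hi]
    refine integral_congr_ae (hi.prod_right_ae.mono fun x hx => ?_)
    exact (integral_prod (fun q : ℝ × ℝ => f (x, q)) hx).symm
  have hfe (p : ℝ × ℝ × ℝ) : ENNReal.ofReal (f p) =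
      ‖angR p.1 p.2.1 ^ (a + b) * (thw t 1 p.2.2 * pdh a b g p.1 p.2.1 p.2.2)‖ₑ ^ 2 := by
    rw [← enorm_pow, Real.enorm_of_nonneg (sq_nonneg _), hf]
    congr 1
    ring
  have hfm : Measurable fun p => ENNReal.ofReal (f p) := by
    simp only [hfe]
    exact (hg.measurable_enorm_weight (t := t) (a + b) a b).pow_const 2
  have e1 : L2w t 1 (a + b) (pdh a b g) ^ 2 = ∫ p, f p
      ∂((volume : Measure ℝ).prod ((volume : Measure ℝ).prod (volume.restrict (Ioi 0)))) := by
    rw [L2w, Real.sq_sqrt, ← h_eq]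
    exact integral_nonneg fun x => integral_nonneg fun y => integral_nonneg fun z => sq_nonneg _
  have e2 : jetL2 t (fun a b => pdh a b g) a b ^ 2 = ∫⁻ p, ENNReal.ofReal (f p)
      ∂((volume : Measure ℝ).prod ((volume : Measure ℝ).prod (volume.restrict (Ioi 0)))) := by
    rw [jetL2, el2_sq, Measure.volume_eq_prod, lintegral_prod, lintegral_prod _ hfm.aemeasurable]
    · refine lintegral_congr fun x => ?_
      rw [lintegral_prod (fun q : ℝ × ℝ => ENNReal.ofReal (f (x, q)))
        (hfm.comp measurable_prodMk_left).aemeasurable]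
      refine lintegral_congr fun y => ?_
      rw [jetNorm, el2_sq]
      exact lintegral_congr fun z => (hfe (x, y, z)).symm
    · exact ((hg.measurable_jetNorm (t := t) (a + b) a b).pow_const 2).aemeasurable
  refine ENNReal.pow_right_strictMono two_ne_zero |>.injective ?_
  rw [e2, ← ENNReal.ofReal_pow (L2w_nonneg _ _ _ _), e1,
    ofReal_integral_eq_lintegral_ofReal hi (ae_of_all _ fun p => sq_nonneg _)]

end assembly

section realBound

open scoped ENNReal

variable {t : ℝ}

/-- The combination of norms of order `n = i + j` to `n + 2` that controls a supremum. -/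
def supSeq (L : ℕ → ℕ → ℝ) (i j : ℕ) : ℝ :=
  (i + j + 1) * ((i + j + 1) * L i j + L i (j + 1)) +
    ((i + j + 1) * L (i + 1) j + L (i + 1) (j + 1))

/-- The combination of norms that controls the derivatives of `-(x ∂_x + y ∂_y) f - 2 f`. -/
def uzSeq (L : ℕ → ℕ → ℝ) (i j : ℕ) : ℝ :=
  L (i + 1) j + L i (j + 1) + (i + j + 2) * L i j

theorem supSeq_nonneg {L : ℕ → ℕ → ℝ} (hL : ∀ i j, 0 ≤ L i j) (i j : ℕ) : 0 ≤ supSeq L i j := by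
  have := hL i j; have := hL (i + 1) j; have := hL i (j + 1); have := hL (i + 1) (j + 1)
  unfold supSeq
  positivity

theorem uzSeq_nonneg {L : ℕ → ℕ → ℝ} (hL : ∀ i j, 0 ≤ L i j) (i j : ℕ) : 0 ≤ uzSeq L i j := by
  have := hL i j; have := hL (i + 1) j; have := hL i (j + 1)
  unfold uzSeq
  positivity

theorem ofReal_natCast_add_add (i j k : ℕ) :
    ENNReal.ofReal ((i : ℝ) + j + k) = (i : ℝ≥0∞) + j + k := by
  exact_mod_cast ENNReal.ofReal_natCast (i + j + k)

theorem ofReal_uzSeq {L : ℕ → ℕ → ℝ} (hL : ∀ i j, 0 ≤ L i j) (i j : ℕ) :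
    ENNReal.ofReal (uzSeq L i j) = ENNReal.ofReal (L (i + 1) j) + ENNReal.ofReal (L i (j + 1)) +
      (i + j + 2) * ENNReal.ofReal (L i j) := by
  have h1 := hL i j; have h2 := hL (i + 1) j; have h3 := hL i (j + 1)
  rw [uzSeq, ENNReal.ofReal_add (by positivity) (by positivity), ENNReal.ofReal_add h2 h3,
    ENNReal.ofReal_mul (by positivity)]
  have := ofReal_natCast_add_add i j 2
  push_cast at this
  rw [this]

theorem ofReal_supSeq {L : ℕ → ℕ → ℝ} (hL : ∀ i j, 0 ≤ L i j) (i j : ℕ) :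
    ENNReal.ofReal (supSeq L i j) =
      (i + j + 1) * ((i + j + 1) * ENNReal.ofReal (L i j) + ENNReal.ofReal (L i (j + 1))) +
      ((i + j + 1) * ENNReal.ofReal (L (i + 1) j) + ENNReal.ofReal (L (i + 1) (j + 1))) := by
  have h1 := hL i j; have h2 := hL (i + 1) j; have h3 := hL i (j + 1)
  have h4 := hL (i + 1) (j + 1)
  have := ofReal_natCast_add_add i j 1
  push_cast at this
  rw [supSeq, ENNReal.ofReal_add (by positivity) (by positivity),
    ENNReal.ofReal_mul (by positivity), ENNReal.ofReal_add (by positivity) h3,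
    ENNReal.ofReal_mul (by positivity), ENNReal.ofReal_add (by positivity) h4,
    ENNReal.ofReal_mul (by positivity), this]

/-- The bound for the term of index `(i, j) + (i', j')` in the Leibniz expansion: the factor with
fewer derivatives is measured in `L^∞`, the other one in `L²`. -/
def splitSeq (L : ℕ → ℕ → ℝ) (i j i' j' : ℕ) : ℝ :=
  if i + j ≤ i' + j' then uzSeq (supSeq L) i j * L i' j' else uzSeq L i j * supSeq L i' j'

theorem splitSeq_nonneg {L : ℕ → ℕ → ℝ} (hL : ∀ i j, 0 ≤ L i j) (i j i' j' : ℕ) :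
    0 ≤ splitSeq L i j i' j' := by
  unfold splitSeq
  split_ifs
  · exact mul_nonneg (uzSeq_nonneg (supSeq_nonneg hL) _ _) (hL _ _)
  · exact mul_nonneg (uzSeq_nonneg hL _ _) (supSeq_nonneg hL _ _)

theorem lintegral_jetNorm_le_splitSeq {G : ℕ → ℕ → ℝ → ℝ → ℝ → ℝ} (hG : HJet G)
    {L : ℕ → ℕ → ℝ} (hL : ∀ i j, 0 ≤ L i j) (h : ∀ a b, jetL2 t G a b = ENNReal.ofReal (L a b))
    (i j i' j' a b : ℕ) :
    ∫⁻ r : ℝ × ℝ, jetNorm t (uzJet G) (i + j) i j r.1 r.2 *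
      jetNorm t G (i' + j') i' j' r.1 r.2 * jetNorm t G (a + b) a b r.1 r.2 ≤
    ENNReal.ofReal (splitSeq L i j i' j' * L a b) := by
  have hsup (i j : ℕ) : jetSup t G i j = ENNReal.ofReal (supSeq L i j) := by
    rw [ofReal_supSeq hL, jetSup, h, h, h, h]
  rw [ENNReal.ofReal_mul (splitSeq_nonneg hL _ _ _ _), ← h a b, splitSeq]
  split_ifs
  · rw [ENNReal.ofReal_mul (uzSeq_nonneg (supSeq_nonneg hL) _ _),
      ofReal_uzSeq (supSeq_nonneg hL), ← hsup, ← hsup, ← hsup, ← h]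
    exact lintegral_jetNorm_le_left hG hG fun x y => jetNorm_uzJet_le_jetSup hG i j x y
  · rw [ENNReal.ofReal_mul (uzSeq_nonneg hL _ _), ofReal_uzSeq hL, ← hsup, ← h, ← h, ← h]
    refine (lintegral_jetNorm_le_right hG.uzJet hG
      fun x y => hG.jetNorm_le_jetL2 i' j' x y).trans ?_
    exact mul_le_mul_left (mul_le_mul_left (jetL2_uzJet_le hG i j) _) _

theorem abs_I4_le (ht : 0 < angT t) {g : ℝ → ℝ → ℝ → ℝ} (hg : SmoothThree g) (h : L2cond t g)
    {L : ℕ → ℕ → ℝ} (hL : ∀ a b, L a b = L2w t 1 (a + b) (pdh a b g)) (a b : ℕ) :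
    |I4 t g a b| ≤ 50 * angT t ^ (-(1 : ℝ) / 4) *
      (∑ p ∈ Finset.HasAntidiagonal.antidiagonal a, ∑ q ∈ Finset.HasAntidiagonal.antidiagonal b,
        (a.choose p.1 : ℝ) * b.choose q.1 * splitSeq L p.1 q.1 p.2 q.2) * L a b := by
  have hL0 (a b : ℕ) : 0 ≤ L a b := hL a b ▸ L2w_nonneg _ _ _ _
  set s : ℝ := angT t ^ (1 / 4 : ℝ) with hs_def
  have hs : 0 < s := Real.rpow_pos_of_pos ht _
  have hst : s ^ 4 = angT t := by
    rw [hs_def, ← Real.rpow_natCast, ← Real.rpow_mul ht.le]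
    norm_num
  have hsi : angT t ^ (-(1 : ℝ) / 4) = s⁻¹ := by
    rw [hs_def, ← Real.rpow_neg ht.le]
    norm_num
  have hG := hg.hjet
  have key := enorm_trip_uzv_mul_pdz_le hs hst hG a b
  have hl2 (a b : ℕ) : jetL2 t (fun a b => pdh a b g) a b = ENNReal.ofReal (L a b) := by
    rw [hL, jetL2_eq_ofReal hG h]
  have hS (p q : ℕ × ℕ) : 0 ≤ (a.choose p.1 : ℝ) * b.choose q.1 *
      (100 * s ^ 3 * (splitSeq L p.1 q.1 p.2 q.2 * L a b)) := by
    have := splitSeq_nonneg hL0 p.1 q.1 p.2 q.2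
    have := hL0 a b
    positivity
  have key2 := key.trans (Finset.sum_le_sum fun p _ => Finset.sum_le_sum fun q _ =>
    show _ ≤ ENNReal.ofReal ((a.choose p.1 : ℝ) * b.choose q.1 *
      (100 * s ^ 3 * (splitSeq L p.1 q.1 p.2 q.2 * L a b))) by
    rw [ENNReal.ofReal_mul (p := (a.choose p.1 : ℝ) * b.choose q.1) (by positivity),
      ENNReal.ofReal_mul (p := (a.choose p.1 : ℝ)) (by positivity),
      ENNReal.ofReal_natCast, ENNReal.ofReal_natCast,
      ENNReal.ofReal_mul (p := 100 * s ^ 3) (by positivity)]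
    exact mul_le_mul_right (mul_le_mul_right
      (lintegral_jetNorm_le_splitSeq hG hL0 hl2 _ _ _ _ _ _) _) _)
  simp only [← ENNReal.ofReal_sum_of_nonneg fun q _ => hS _ q] at key2
  rw [← ENNReal.ofReal_sum_of_nonneg fun p _ => Finset.sum_nonneg fun q _ => hS p q,
    Real.enorm_eq_ofReal_abs, ENNReal.ofReal_le_ofReal_iff
      (Finset.sum_nonneg fun p _ => Finset.sum_nonneg fun q _ => hS p q)] at key2
  rw [I4, abs_mul, abs_of_pos (a := 1 / (2 * angT t)) (by positivity)]
  refine (mul_le_mul_of_nonneg_left key2 (by positivity)).trans (le_of_eq ?_)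
  rw [hsi, ← hst, Finset.mul_sum, Finset.mul_sum, Finset.sum_mul]
  refine Finset.sum_congr rfl fun p _ => ?_
  rw [Finset.mul_sum, Finset.mul_sum, Finset.sum_mul]
  refine Finset.sum_congr rfl fun q _ => ?_
  field_simp
  ring

end realBound

section combinatorics

open Finset

theorem sum_range_sum_antidiagonal_le {f : ℕ → ℕ → ℝ} (hf : ∀ i j, 0 ≤ f i j) (N : ℕ) :
    ∑ n ∈ range N, ∑ p ∈ HasAntidiagonal.antidiagonal n, f p.1 p.2 ≤
      ∑ i ∈ range N, ∑ j ∈ range N, f i j := by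
  rw [← sum_product']
  refine le_trans (le_of_eq ?_) (sum_le_sum_of_subset_of_nonneg
    (filter_subset (fun p : ℕ × ℕ => p.1 + p.2 < N) _) fun p _ _ => hf _ _)
  rw [← sum_fiberwise_of_maps_to (t := range N) (g := fun p : ℕ × ℕ => p.1 + p.2)
    (fun p hp => Finset.mem_range.2 (mem_filter.1 hp).2)]
  refine sum_congr rfl fun n hn => sum_congr ?_ fun _ _ => rfl
  ext p
  rw [Finset.mem_range] at hn
  simp only [HasAntidiagonal.mem_antidiagonal, mem_filter, mem_product, Finset.mem_range]
  omega

theorem sum_range_sum_range_le_antidiagonal {f : ℕ → ℕ → ℝ} (hf : ∀ i j, 0 ≤ f i j) (N : ℕ) :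
    ∑ i ∈ range N, ∑ j ∈ range N, f i j ≤
      ∑ n ∈ range (2 * N), ∑ p ∈ HasAntidiagonal.antidiagonal n, f p.1 p.2 := by
  rw [← sum_product', ← sum_fiberwise_of_maps_to (t := range (2 * N))
    (g := fun p : ℕ × ℕ => p.1 + p.2) (fun p hp => by
      simp only [mem_product, Finset.mem_range] at hp ⊢
      omega)]
  refine sum_le_sum fun n _ => sum_le_sum_of_subset_of_nonneg (fun p hp => ?_) fun p _ _ => hf _ _
  exact HasAntidiagonal.mem_antidiagonal.2 (mem_filter.1 hp).2

theorem sum_range_sum_convolution_le {f h : ℕ → ℕ → ℝ} (hf : ∀ i j, 0 ≤ f i j)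
    (hh : ∀ i j, 0 ≤ h i j) (N : ℕ) :
    ∑ n ∈ range N, ∑ c ∈ HasAntidiagonal.antidiagonal n,
      ∑ p ∈ HasAntidiagonal.antidiagonal c.1, ∑ q ∈ HasAntidiagonal.antidiagonal c.2,
        f p.1 q.1 * h p.2 q.2 ≤
      (∑ i ∈ range N, ∑ j ∈ range N, f i j) * ∑ i ∈ range N, ∑ j ∈ range N, h i j := by
  have h0 (i j i' j' : ℕ) : 0 ≤ f i j * h i' j' := mul_nonneg (hf _ _) (hh _ _)
  calc _ ≤ ∑ a ∈ range N, ∑ b ∈ range N, ∑ p ∈ HasAntidiagonal.antidiagonal a,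
        ∑ q ∈ HasAntidiagonal.antidiagonal b, f p.1 q.1 * h p.2 q.2 :=
        sum_range_sum_antidiagonal_le (fun a b => sum_nonneg fun _ _ => sum_nonneg fun _ _ =>
          h0 _ _ _ _) N
    _ = ∑ a ∈ range N, ∑ p ∈ HasAntidiagonal.antidiagonal a, ∑ b ∈ range N,
        ∑ q ∈ HasAntidiagonal.antidiagonal b, f p.1 q.1 * h p.2 q.2 :=
        sum_congr rfl fun a _ => sum_comm
    _ ≤ ∑ a ∈ range N, ∑ p ∈ HasAntidiagonal.antidiagonal a, ∑ j ∈ range N, ∑ j' ∈ range N,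
        f p.1 j * h p.2 j' := sum_le_sum fun a _ => sum_le_sum fun p _ =>
          sum_range_sum_antidiagonal_le (f := fun j j' => f p.1 j * h p.2 j')
            (fun _ _ => h0 _ _ _ _) N
    _ ≤ ∑ i ∈ range N, ∑ i' ∈ range N, ∑ j ∈ range N, ∑ j' ∈ range N, f i j * h i' j' :=
        sum_range_sum_antidiagonal_le
          (f := fun i i' => ∑ j ∈ range N, ∑ j' ∈ range N, f i j * h i' j')
          (fun _ _ => sum_nonneg fun _ _ => sum_nonneg fun _ _ => h0 _ _ _ _) N
    _ = _ := by
        simp only [sum_mul_sum]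

/-- All partial sums of `f` over squares are at most `B`. -/
def SquareSumLE (f : ℕ → ℕ → ℝ) (B : ℝ) : Prop :=
  ∀ N : ℕ, ∑ i ∈ range N, ∑ j ∈ range N, f i j ≤ B

namespace SquareSumLE

variable {f h : ℕ → ℕ → ℝ} {A B : ℝ}

theorem mono (hh : SquareSumLE h B) (hfh : ∀ i j, f i j ≤ h i j) : SquareSumLE f B := fun N =>
  (sum_le_sum fun i _ => sum_le_sum fun j _ => hfh i j).trans (hh N)

theorem add (hf : SquareSumLE f A) (hh : SquareSumLE h B) :
    SquareSumLE (fun i j => f i j + h i j) (A + B) := fun N => by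
  simp only [sum_add_distrib]
  exact add_le_add (hf N) (hh N)

theorem const_mul (hf : SquareSumLE f A) {c : ℝ} (hc : 0 ≤ c) :
    SquareSumLE (fun i j => c * f i j) (c * A) := fun N => by
  simp only [← mul_sum]
  exact mul_le_mul_of_nonneg_left (hf N) hc

theorem shift_left (hf : SquareSumLE f A) (h0 : ∀ i j, 0 ≤ f i j) :
    SquareSumLE (fun i j => f (i + 1) j) A := fun N => by
  refine le_trans ?_ (hf (N + 1))
  rw [sum_range_succ' _ N]
  refine le_add_of_le_of_nonneg (sum_le_sum fun i _ => ?_) (sum_nonneg fun j _ => h0 _ _)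
  rw [sum_range_succ]
  exact le_add_of_nonneg_right (h0 _ _)

theorem shift_right (hf : SquareSumLE f A) (h0 : ∀ i j, 0 ≤ f i j) :
    SquareSumLE (fun i j => f i (j + 1)) A := fun N => by
  have h : SquareSumLE (fun i j => f j i) A := fun N => by
    rw [sum_comm]
    exact hf N
  rw [sum_comm]
  exact h.shift_left (fun i j => h0 j i) N

theorem of_summable (h0 : ∀ i j, 0 ≤ f i j)
    (hs : Summable fun n => ∑ p ∈ HasAntidiagonal.antidiagonal n, f p.1 p.2) :
    SquareSumLE f (∑' n, ∑ p ∈ HasAntidiagonal.antidiagonal n, f p.1 p.2) := fun N =>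
  (sum_range_sum_range_le_antidiagonal h0 N).trans
    (hs.sum_le_tsum _ fun _ _ => sum_nonneg fun _ _ => h0 _ _)

end SquareSumLE

theorem Mfac_pos (n : ℕ) : 0 < Mfac n := by
  unfold Mfac
  positivity

theorem choose_mul_choose_le {i i' j j' : ℕ} :
    (i + i').choose i * (j + j').choose j ≤ (i + j + (i' + j')).choose (i + j) := by
  rw [show i + j + (i' + j') = i + i' + (j + j') by ring, Nat.add_choose_eq (i + i') (j + j')]
  exact single_le_sum (f := fun p : ℕ × ℕ => (i + i').choose p.1 * (j + j').choose p.2)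
    (fun _ _ => Nat.zero_le _) (HasAntidiagonal.mem_antidiagonal.2 (rfl : (i, j).1 + (i, j).2 = _))

/-- The weights satisfy `C(a,i) C(b,j) M_{k+m} ≤ 16 M_m / k!` when `k = i + j ≤ m`. -/
theorem choose_mul_choose_mul_Mfac_le {i i' j j' : ℕ} (h : i + j ≤ i' + j') :
    ((i + i').choose i : ℝ) * (j + j').choose j * Mfac (i + i' + (j + j')) ≤
      16 * (((i + j).factorial : ℝ)⁻¹ * Mfac (i' + j')) := by
  have h1 : ((i + i').choose i : ℝ) * (j + j').choose j ≤
      ((i + j + (i' + j')).choose (i + j) : ℝ) := by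
    exact_mod_cast choose_mul_choose_le
  have h2 : ((i + j + (i' + j')).choose (i + j) : ℝ) =
      (i + j + (i' + j')).factorial / ((i + j).factorial * (i' + j').factorial) :=
    Nat.cast_add_choose ℝ
  rw [show i + i' + (j + j') = i + j + (i' + j') by ring]
  refine (mul_le_mul_of_nonneg_right h1 (Mfac_pos _).le).trans ?_
  rw [h2]
  unfold Mfac
  have h3 : (((i + j + (i' + j') : ℕ) : ℝ) + 1) ^ 4 ≤ 16 * (((i' + j' : ℕ) : ℝ) + 1) ^ 4 := by
    have : ((i + j : ℕ) : ℝ) ≤ ((i' + j' : ℕ) : ℝ) := by exact_mod_cast h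
    calc (((i + j + (i' + j') : ℕ) : ℝ) + 1) ^ 4 ≤ (2 * (((i' + j' : ℕ) : ℝ) + 1)) ^ 4 := by
          rw [Nat.cast_add (i + j)]
          gcongr
          linarith
      _ = _ := by ring
  calc _ = (((i + j + (i' + j') : ℕ) : ℝ) + 1) ^ 4 /
        ((i + j).factorial * (i' + j').factorial) := by
        field_simp
    _ ≤ 16 * (((i' + j' : ℕ) : ℝ) + 1) ^ 4 / ((i + j).factorial * (i' + j').factorial) := by
        gcongr
    _ = _ := by field_simp

variable {L : ℕ → ℕ → ℝ} {τ : ℝ}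

theorem choose_mul_splitSeq_le (hL : ∀ i j, 0 ≤ L i j) (hτ : 0 < τ) (i i' j j' : ℕ) :
    τ ^ (i + i' + (j + j')) * Mfac (i + i' + (j + j')) *
      ((i + i').choose i * (j + j').choose j * splitSeq L i j i' j') ≤
    16 * ((τ ^ (i + j) / (i + j).factorial * uzSeq (supSeq L) i j) *
        (L i' j' * τ ^ (i' + j') * Mfac (i' + j')) +
      (τ ^ (i + j) * Mfac (i + j) * uzSeq L i j) *
        (τ ^ (i' + j') / (i' + j').factorial * supSeq L i' j')) := by
  have hA := uzSeq_nonneg (supSeq_nonneg hL) i j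
  have hD := uzSeq_nonneg hL i j
  have hE := supSeq_nonneg hL i' j'
  have hX := hL i' j'
  have hM := (Mfac_pos (i + j)).le
  have hM' := (Mfac_pos (i' + j')).le
  have hpow : τ ^ (i + i' + (j + j')) = τ ^ (i + j) * τ ^ (i' + j') := by
    rw [← pow_add]
    ring_nf
  unfold splitSeq
  split_ifs with h
  · have := choose_mul_choose_mul_Mfac_le h
    calc _ = τ ^ (i + j) * τ ^ (i' + j') * (uzSeq (supSeq L) i j * L i' j') *
          (((i + i').choose i : ℝ) * (j + j').choose j * Mfac (i + i' + (j + j'))) := by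
          rw [hpow]
          ring
      _ ≤ τ ^ (i + j) * τ ^ (i' + j') * (uzSeq (supSeq L) i j * L i' j') *
          (16 * (((i + j).factorial : ℝ)⁻¹ * Mfac (i' + j'))) := by gcongr
      _ = 16 * ((τ ^ (i + j) / (i + j).factorial * uzSeq (supSeq L) i j) *
          (L i' j' * τ ^ (i' + j') * Mfac (i' + j'))) := by ring
      _ ≤ _ := by
          gcongr
          exact le_add_of_nonneg_right (by positivity)
  · have := choose_mul_choose_mul_Mfac_le (i := i') (i' := i) (j := j') (j' := j) (by omega)
    rw [Nat.choose_symm_add, Nat.choose_symm_add (a := j'), add_comm i' i, add_comm j' j] at this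
    calc _ = τ ^ (i + j) * τ ^ (i' + j') * (uzSeq L i j * supSeq L i' j') *
          (((i + i').choose i : ℝ) * (j + j').choose j * Mfac (i + i' + (j + j'))) := by
          rw [hpow]
          ring
      _ ≤ τ ^ (i + j) * τ ^ (i' + j') * (uzSeq L i j * supSeq L i' j') *
          (16 * (((i' + j').factorial : ℝ)⁻¹ * Mfac (i + j))) := by gcongr
      _ = 16 * ((τ ^ (i + j) * Mfac (i + j) * uzSeq L i j) *
          (τ ^ (i' + j') / (i' + j').factorial * supSeq L i' j')) := by ring
      _ ≤ _ := by
          gcongr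
          exact le_add_of_nonneg_left (by positivity)

end combinatorics

section weights

variable {L : ℕ → ℕ → ℝ} {τ l : ℝ}

/-- The summands of the analytic norm `‖·‖_{X_τ}`, indexed by multi-indices. -/
def xSeq (τ : ℝ) (L : ℕ → ℕ → ℝ) (i j : ℕ) : ℝ := L i j * τ ^ (i + j) * Mfac (i + j)

/-- The summands of the analytic norm `‖·‖_{Y_τ}`, indexed by multi-indices. -/
def ySeq (τ : ℝ) (L : ℕ → ℕ → ℝ) (i j : ℕ) : ℝ :=
  L i j * τ ^ (i + j - 1) * ((i + j : ℕ) : ℝ) * Mfac (i + j)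

theorem xSeq_nonneg (hL : ∀ i j, 0 ≤ L i j) (hτ : 0 < τ) (i j : ℕ) : 0 ≤ xSeq τ L i j :=
  mul_nonneg (mul_nonneg (hL i j) (pow_pos hτ _).le) (Mfac_pos _).le

theorem ySeq_nonneg (hL : ∀ i j, 0 ≤ L i j) (hτ : 0 < τ) (i j : ℕ) : 0 ≤ ySeq τ L i j :=
  mul_nonneg (mul_nonneg (mul_nonneg (hL i j) (pow_pos hτ _).le) (Nat.cast_nonneg _))
    (Mfac_pos _).le

theorem mul_le_weight_zero (hτ : 0 < τ) (hl : 0 ≤ l) (n : ℕ) :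
    (n + 2) * (τ ^ n / n.factorial * ((n + 1) * ((n + 1) * l))) ≤ 2 * (l * τ ^ n * Mfac n) := by
  rw [← sub_nonneg]
  have : 2 * (l * τ ^ n * Mfac n) - (n + 2) * (τ ^ n / n.factorial * ((n + 1) * ((n + 1) * l))) =
      l * τ ^ n / n.factorial * (2 * ((n : ℝ) + 1) ^ 4 - (n + 2) * (n + 1) ^ 2) := by
    unfold Mfac
    ring
  rw [this]
  refine mul_nonneg (by positivity) ?_
  ring_nf
  positivity

theorem mul_le_weight_one (hτ : 0 < τ) (hl : 0 ≤ l) (n : ℕ) :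
    τ ^ n / n.factorial * ((n + 2) * ((n + 2) * l)) ≤
      τ⁻¹ * (l * τ ^ (n + 1) * Mfac (n + 1)) := by
  rw [← sub_nonneg]
  have : τ⁻¹ * (l * τ ^ (n + 1) * Mfac (n + 1)) -
      τ ^ n / n.factorial * ((n + 2) * ((n + 2) * l)) =
      l * τ ^ n / ((n + 1) * n.factorial) * (((n : ℝ) + 2) ^ 4 - (n + 2) ^ 2 * (n + 1)) := by
    unfold Mfac
    rw [Nat.factorial_succ]
    push_cast
    field_simp
    ring
  rw [this]
  refine mul_nonneg (by positivity) ?_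
  ring_nf
  positivity

theorem mul_le_weight_two (hτ : 0 < τ) (hl : 0 ≤ l) (n : ℕ) :
    τ ^ n / n.factorial * ((n + 2) * l) ≤ (τ ^ 2)⁻¹ * (l * τ ^ (n + 2) * Mfac (n + 2)) := by
  rw [← sub_nonneg]
  have : (τ ^ 2)⁻¹ * (l * τ ^ (n + 2) * Mfac (n + 2)) - τ ^ n / n.factorial * ((n + 2) * l) =
      l * τ ^ n / ((n + 2) * (n + 1) * n.factorial) *
        (((n : ℝ) + 3) ^ 4 - (n + 2) ^ 2 * (n + 1)) := by
    unfold Mfac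
    rw [Nat.factorial_succ, Nat.factorial_succ]
    push_cast
    field_simp
    ring
  rw [this]
  refine mul_nonneg (by positivity) ?_
  ring_nf
  positivity

theorem mul_le_weight_three (hτ : 0 < τ) (hl : 0 ≤ l) (n : ℕ) :
    τ ^ n / n.factorial * l ≤
      (τ ^ 2)⁻¹ * (l * τ ^ (n + 2) * ((n + 3 : ℕ) : ℝ) * Mfac (n + 3)) := by
  rw [← sub_nonneg]
  have : (τ ^ 2)⁻¹ * (l * τ ^ (n + 2) * ((n + 3 : ℕ) : ℝ) * Mfac (n + 3)) -
      τ ^ n / n.factorial * l =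
      l * τ ^ n / ((n + 2) * (n + 1) * n.factorial) *
        (((n : ℝ) + 4) ^ 4 - (n + 2) * (n + 1)) := by
    unfold Mfac
    rw [Nat.factorial_succ, Nat.factorial_succ, Nat.factorial_succ]
    push_cast
    field_simp
    ring
  rw [this]
  refine mul_nonneg (by positivity) ?_
  ring_nf
  positivity

theorem mul_le_weight_deriv (hτ : 0 < τ) (hl : 0 ≤ l) (n : ℕ) :
    τ ^ n * Mfac n * l ≤ l * τ ^ n * ((n + 1 : ℕ) : ℝ) * Mfac (n + 1) := by
  rw [← sub_nonneg]
  have : l * τ ^ n * ((n + 1 : ℕ) : ℝ) * Mfac (n + 1) - τ ^ n * Mfac n * l =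
      l * τ ^ n / n.factorial * (((n : ℝ) + 2) ^ 4 - (n + 1) ^ 4) := by
    unfold Mfac
    rw [Nat.factorial_succ]
    push_cast
    field_simp
    ring
  rw [this]
  refine mul_nonneg (by positivity) ?_
  ring_nf
  positivity

theorem xSeq_succ_left (i j : ℕ) :
    xSeq τ L (i + 1) j = L (i + 1) j * τ ^ (i + j + 1) * Mfac (i + j + 1) := by
  rw [xSeq, show i + 1 + j = i + j + 1 by ring]

theorem ySeq_succ_left (i j : ℕ) : ySeq τ L (i + 1) j =
    L (i + 1) j * τ ^ (i + j) * ((i + j + 1 : ℕ) : ℝ) * Mfac (i + j + 1) := by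
  rw [ySeq, show i + 1 + j = i + j + 1 by ring, Nat.add_sub_cancel]

theorem mul_supSeq_le (hL : ∀ i j, 0 ≤ L i j) (hτ : 0 < τ) (i j : ℕ) :
    (i + j + 2) * (τ ^ (i + j) / (i + j).factorial * supSeq L i j) ≤
      2 * xSeq τ L i j + τ⁻¹ * (xSeq τ L (i + 1) j + xSeq τ L i (j + 1)) +
        (τ ^ 2)⁻¹ * xSeq τ L (i + 1) (j + 1) := by
  have h0 := mul_le_weight_zero hτ (hL i j) (i + j)
  have h1 := mul_le_weight_one hτ (hL i (j + 1)) (i + j)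
  have h2 := mul_le_weight_one hτ (hL (i + 1) j) (i + j)
  have h3 := mul_le_weight_two hτ (hL (i + 1) (j + 1)) (i + j)
  have hn (l : ℝ) (hl : 0 ≤ l) : (i + j + 2 : ℝ) * (τ ^ (i + j) / (i + j).factorial *
      ((i + j + 1) * l)) ≤ τ ^ (i + j) / (i + j).factorial * ((i + j + 2) * ((i + j + 2) * l)) := by
    rw [mul_left_comm]
    gcongr
    norm_num
  have h1' := hn _ (hL i (j + 1))
  have h2' := hn _ (hL (i + 1) j)
  rw [xSeq_succ_left, xSeq_succ_left, xSeq, xSeq, supSeq]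
  push_cast at h0 h1 h2 h3
  rw [show i + (j + 1) = i + j + 1 by ring]
  linear_combination h0 + h1 + h1' + h2 + h2' + h3

theorem supSeq_succ_le (hL : ∀ i j, 0 ≤ L i j) (hτ : 0 < τ) (i j : ℕ) :
    τ ^ (i + j) / (i + j).factorial * supSeq L (i + 1) j ≤
      τ⁻¹ * xSeq τ L (i + 1) j + (τ ^ 2)⁻¹ * (xSeq τ L (i + 2) j + xSeq τ L (i + 1) (j + 1) +
        ySeq τ L (i + 2) (j + 1)) := by
  have h1 := mul_le_weight_one hτ (hL (i + 1) j) (i + j)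
  have h2 := mul_le_weight_two hτ (hL (i + 2) j) (i + j)
  have h3 := mul_le_weight_two hτ (hL (i + 1) (j + 1)) (i + j)
  have h4 := mul_le_weight_three hτ (hL (i + 2) (j + 1)) (i + j)
  rw [xSeq, xSeq, xSeq, ySeq, supSeq, show i + 1 + j = i + j + 1 by ring,
    show i + 2 + j = i + j + 2 by ring, show i + 1 + (j + 1) = i + j + 2 by ring,
    show i + 2 + (j + 1) = i + j + 3 by ring, show i + j + 3 - 1 = i + j + 2 by omega]
  push_cast at h1 h2 h3 h4 ⊢
  linear_combination h1 + h2 + h3 + h4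

theorem xSeq_swap (i j : ℕ) : xSeq τ (fun a b => L b a) i j = xSeq τ L j i := by
  rw [xSeq, xSeq, add_comm i]

theorem ySeq_swap (i j : ℕ) : ySeq τ (fun a b => L b a) i j = ySeq τ L j i := by
  rw [ySeq, ySeq, add_comm i]

theorem supSeq_succ_right_le (hL : ∀ i j, 0 ≤ L i j) (hτ : 0 < τ) (i j : ℕ) :
    τ ^ (i + j) / (i + j).factorial * supSeq L i (j + 1) ≤
      τ⁻¹ * xSeq τ L i (j + 1) + (τ ^ 2)⁻¹ * (xSeq τ L i (j + 2) + xSeq τ L (i + 1) (j + 1) +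
        ySeq τ L (i + 1) (j + 2)) := by
  have h := supSeq_succ_le (L := fun a b => L b a) (fun a b => hL b a) hτ j i
  simp only [xSeq_swap, ySeq_swap] at h
  rw [add_comm j i] at h
  refine le_trans (le_of_eq ?_) h
  simp only [supSeq]
  ring

theorem mul_uzSeq_le (hL : ∀ i j, 0 ≤ L i j) (hτ : 0 < τ) (i j : ℕ) :
    τ ^ (i + j) * Mfac (i + j) * uzSeq L i j ≤
      ySeq τ L (i + 1) j + ySeq τ L i (j + 1) + 2 * xSeq τ L i j + τ * ySeq τ L i j := by
  have h1 := mul_le_weight_deriv hτ (hL (i + 1) j) (i + j)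
  have h2 := mul_le_weight_deriv hτ (hL i (j + 1)) (i + j)
  have h3 : τ * ySeq τ L i j = L i j * τ ^ (i + j) * ((i + j : ℕ) : ℝ) * Mfac (i + j) := by
    rw [ySeq]
    rcases Nat.eq_zero_or_pos (i + j) with h | h
    · simp [h]
    · conv_rhs => rw [← Nat.sub_add_cancel h, pow_succ, Nat.sub_add_cancel h]
      ring
  rw [h3, ySeq_succ_left, ySeq, show i + (j + 1) = i + j + 1 by ring, Nat.add_sub_cancel, xSeq,
    uzSeq]
  push_cast at h1 h2 ⊢
  linear_combination h1 + h2

variable {A B : ℝ}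

theorem squareSumLE_supSeq (hL : ∀ i j, 0 ≤ L i j) (hτ : 0 < τ) (hX : SquareSumLE (xSeq τ L) A) :
    SquareSumLE (fun i j => τ ^ (i + j) / (i + j).factorial * supSeq L i j)
      (2 * A + τ⁻¹ * (A + A) + (τ ^ 2)⁻¹ * A) := by
  have h0 := xSeq_nonneg hL hτ
  have hτ1 : 0 ≤ τ⁻¹ := by positivity
  have hτ2 : 0 ≤ (τ ^ 2)⁻¹ := by positivity
  refine (((hX.const_mul zero_le_two).add (((hX.shift_left h0).add
    (hX.shift_right h0)).const_mul hτ1)).add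
    (((hX.shift_left h0).shift_right fun i j => h0 _ _).const_mul hτ2)).mono fun i j => ?_
  refine le_trans ?_ (mul_supSeq_le hL hτ i j)
  refine le_mul_of_one_le_left (mul_nonneg (by positivity) (supSeq_nonneg hL i j)) ?_
  have : (0 : ℝ) ≤ i + j := by positivity
  linarith

theorem squareSumLE_uzSeq_supSeq (hL : ∀ i j, 0 ≤ L i j) (hτ : 0 < τ)
    (hX : SquareSumLE (xSeq τ L) A) (hY : SquareSumLE (ySeq τ L) B) :
    SquareSumLE (fun i j => τ ^ (i + j) / (i + j).factorial * uzSeq (supSeq L) i j)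
      (τ⁻¹ * A + (τ ^ 2)⁻¹ * (A + A + B) + (τ⁻¹ * A + (τ ^ 2)⁻¹ * (A + A + B)) +
        (2 * A + τ⁻¹ * (A + A) + (τ ^ 2)⁻¹ * A)) := by
  have h0 := xSeq_nonneg hL hτ
  have h0' := ySeq_nonneg hL hτ
  have hτ1 : 0 ≤ τ⁻¹ := by positivity
  have hτ2 : 0 ≤ (τ ^ 2)⁻¹ := by positivity
  have x10 := hX.shift_left h0
  have x01 := hX.shift_right h0
  have x11 := x10.shift_right fun i j => h0 _ _
  have x20 := x10.shift_left fun i j => h0 _ _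
  have x02 := x01.shift_right fun i j => h0 _ _
  have y11 := (hY.shift_left h0').shift_right fun i j => h0' _ _
  have y21 := y11.shift_left fun i j => h0' _ _
  have y12 := y11.shift_right fun i j => h0' _ _
  refine ((((x10.const_mul hτ1).add (((x20.add x11).add y21).const_mul hτ2)).add
    ((x01.const_mul hτ1).add (((x02.add x11).add y12).const_mul hτ2))).add
    (((hX.const_mul zero_le_two).add ((x10.add x01).const_mul hτ1)).add
      (x11.const_mul hτ2))).mono fun i j => ?_
  have h1 := supSeq_succ_le hL hτ i j
  have h2 := supSeq_succ_right_le hL hτ i j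
  have h3 := mul_supSeq_le hL hτ i j
  refine le_trans (le_of_eq ?_) (add_le_add (add_le_add h1 h2) h3)
  rw [uzSeq]
  ring

theorem squareSumLE_uzSeq (hL : ∀ i j, 0 ≤ L i j) (hτ : 0 < τ)
    (hX : SquareSumLE (xSeq τ L) A) (hY : SquareSumLE (ySeq τ L) B) :
    SquareSumLE (fun i j => τ ^ (i + j) * Mfac (i + j) * uzSeq L i j)
      (B + B + 2 * A + τ * B) :=
  ((((hY.shift_left (ySeq_nonneg hL hτ)).add (hY.shift_right (ySeq_nonneg hL hτ))).add
    (hX.const_mul zero_le_two)).add (hY.const_mul hτ.le)).mono (mul_uzSeq_le hL hτ)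

end weights

section conclusion

variable {t τ : ℝ} {g : ℝ → ℝ → ℝ → ℝ}

/-- The weighted norm of the derivative of multi-index `(a, b)`. -/
def hNorm (t : ℝ) (g : ℝ → ℝ → ℝ → ℝ) (a b : ℕ) : ℝ := L2w t 1 (a + b) (pdh a b g)

theorem hNorm_nonneg (t : ℝ) (g : ℝ → ℝ → ℝ → ℝ) (a b : ℕ) : 0 ≤ hNorm t g a b :=
  L2w_nonneg _ _ _ _

theorem sum_range_L2w (f : ℕ → ℕ → ℝ → ℝ) (n : ℕ) :
    ∑ a ∈ Finset.range (n + 1), f a (n - a) (L2w t 1 n (pdh a (n - a) g)) =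
      ∑ p ∈ Finset.HasAntidiagonal.antidiagonal n, f p.1 p.2 (hNorm t g p.1 p.2) := by
  rw [Finset.Nat.sum_antidiagonal_eq_sum_range_succ fun a b => f a b (hNorm t g a b)]
  refine Finset.sum_congr rfl fun a ha => ?_
  rw [hNorm, Nat.add_sub_of_le (Nat.lt_succ_iff.1 (Finset.mem_range.1 ha))]

theorem Xel_eq (n : ℕ) : Xel t τ g n =
    ∑ p ∈ Finset.HasAntidiagonal.antidiagonal n, xSeq τ (hNorm t g) p.1 p.2 := by
  rw [Xel, sum_range_L2w fun _ _ l => l, Finset.sum_mul, Finset.sum_mul]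
  refine Finset.sum_congr rfl fun p hp => ?_
  rw [xSeq, Finset.HasAntidiagonal.mem_antidiagonal.1 hp]

theorem Yel_eq (n : ℕ) : Yel t τ g n =
    ∑ p ∈ Finset.HasAntidiagonal.antidiagonal n, ySeq τ (hNorm t g) p.1 p.2 := by
  rw [Yel, sum_range_L2w fun _ _ l => l, Finset.sum_mul, Finset.sum_mul, Finset.sum_mul]
  refine Finset.sum_congr rfl fun p hp => ?_
  rw [ySeq, Finset.HasAntidiagonal.mem_antidiagonal.1 hp]

theorem Qterm_I4_le (ht : 0 < angT t) (hτ : 0 < τ) (hg : SmoothThree g) (h : L2cond t g) (n : ℕ) :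
    Qterm t τ g (I4 t g) n ≤ 50 * angT t ^ (-(1 : ℝ) / 4) *
      ∑ c ∈ Finset.HasAntidiagonal.antidiagonal n, ∑ p ∈ Finset.HasAntidiagonal.antidiagonal c.1,
        ∑ q ∈ Finset.HasAntidiagonal.antidiagonal c.2, τ ^ (c.1 + c.2) * Mfac (c.1 + c.2) *
          (c.1.choose p.1 * c.2.choose q.1 * splitSeq (hNorm t g) p.1 q.1 p.2 q.2) := by
  rw [Qterm, sum_range_L2w fun a b l => |I4 t g a b| * τ ^ n * Mfac n / l, Finset.mul_sum]
  refine Finset.sum_le_sum fun c hc => ?_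
  rw [Finset.HasAntidiagonal.mem_antidiagonal] at hc
  have hM := (Mfac_pos n).le
  have hT : 0 ≤ angT t ^ (-(1 : ℝ) / 4) := Real.rpow_nonneg ht.le _
  have hS := splitSeq_nonneg (hNorm_nonneg t g)
  have hI := abs_I4_le ht hg h (L := hNorm t g) (fun _ _ => rfl) c.1 c.2
  simp only [← Finset.mul_sum]
  rw [hc]
  refine div_le_of_le_mul₀ (hNorm_nonneg t g _ _) ?_ ?_
  · have : 0 ≤ ∑ p ∈ Finset.HasAntidiagonal.antidiagonal c.1,
        ∑ q ∈ Finset.HasAntidiagonal.antidiagonal c.2,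
        (c.1.choose p.1 : ℝ) * c.2.choose q.1 * splitSeq (hNorm t g) p.1 q.1 p.2 q.2 :=
      Finset.sum_nonneg fun p _ => Finset.sum_nonneg fun q _ =>
        mul_nonneg (by positivity) (hS _ _ _ _)
    positivity
  · rw [mul_assoc]
    refine (mul_le_mul_of_nonneg_right hI (by positivity)).trans (le_of_eq ?_)
    ring

theorem sum_Qterm_I4_le (ht : 0 < angT t) (hτ : 0 < τ) (hg : SmoothThree g) (h : L2cond t g)
    (hX : Summable (Xel t τ g)) (hY : Summable (Yel t τ g)) (N : ℕ) :
    ∑ n ∈ Finset.range N, Qterm t τ g (I4 t g) n ≤ 50 * angT t ^ (-(1 : ℝ) / 4) * (16 *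
      ((2 * Xnrm t τ g + 4 * τ⁻¹ * Xnrm t τ g + (τ ^ 2)⁻¹ * (5 * Xnrm t τ g + 2 * Ynrm t τ g)) *
          Xnrm t τ g +
        (2 * Ynrm t τ g + 2 * Xnrm t τ g + τ * Ynrm t τ g) *
          ((2 + 2 * τ⁻¹ + (τ ^ 2)⁻¹) * Xnrm t τ g))) := by
  have hL := hNorm_nonneg t g
  have hsX : SquareSumLE (xSeq τ (hNorm t g)) (Xnrm t τ g) := by
    have := SquareSumLE.of_summable (xSeq_nonneg hL hτ) (hX.congr Xel_eq)
    simp only [← Xel_eq] at this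
    exact this
  have hsY : SquareSumLE (ySeq τ (hNorm t g)) (Ynrm t τ g) := by
    have := SquareSumLE.of_summable (ySeq_nonneg hL hτ) (hY.congr Yel_eq)
    simp only [← Yel_eq] at this
    exact this
  have hsA := squareSumLE_uzSeq_supSeq hL hτ hsX hsY
  have hsD := squareSumLE_uzSeq hL hτ hsX hsY
  have hsE := squareSumLE_supSeq hL hτ hsX
  have hx := xSeq_nonneg hL hτ
  have ha (i j : ℕ) : 0 ≤ τ ^ (i + j) / (i + j).factorial * uzSeq (supSeq (hNorm t g)) i j :=
    mul_nonneg (by positivity) (uzSeq_nonneg (supSeq_nonneg hL) i j)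
  have hd (i j : ℕ) : 0 ≤ τ ^ (i + j) * Mfac (i + j) * uzSeq (hNorm t g) i j :=
    mul_nonneg (mul_nonneg (by positivity) (Mfac_pos _).le) (uzSeq_nonneg hL i j)
  have he (i j : ℕ) : 0 ≤ τ ^ (i + j) / (i + j).factorial * supSeq (hNorm t g) i j :=
    mul_nonneg (by positivity) (supSeq_nonneg hL i j)
  have hT : 0 ≤ angT t ^ (-(1 : ℝ) / 4) := Real.rpow_nonneg ht.le _
  have hnn {f : ℕ → ℕ → ℝ} (hf : ∀ i j, 0 ≤ f i j) :
      0 ≤ ∑ i ∈ Finset.range N, ∑ j ∈ Finset.range N, f i j :=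
    Finset.sum_nonneg fun _ _ => Finset.sum_nonneg fun _ _ => hf _ _
  have c1 := (sum_range_sum_convolution_le ha hx N).trans
    (mul_le_mul (hsA N) (hsX N) (hnn hx) ((hnn ha).trans (hsA N)))
  have c2 := (sum_range_sum_convolution_le hd he N).trans
    (mul_le_mul (hsD N) (hsE N) (hnn he) ((hnn hd).trans (hsD N)))
  refine (Finset.sum_le_sum fun n _ => Qterm_I4_le ht hτ hg h n).trans ?_
  rw [← Finset.mul_sum]
  refine mul_le_mul_of_nonneg_left ?_ (by positivity)
  calc
    _ ≤ ∑ n ∈ Finset.range N, ∑ c ∈ Finset.HasAntidiagonal.antidiagonal n,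
        ∑ p ∈ Finset.HasAntidiagonal.antidiagonal c.1,
        ∑ q ∈ Finset.HasAntidiagonal.antidiagonal c.2,
        16 * ((τ ^ (p.1 + q.1) / (p.1 + q.1).factorial * uzSeq (supSeq (hNorm t g)) p.1 q.1) *
            xSeq τ (hNorm t g) p.2 q.2 +
          (τ ^ (p.1 + q.1) * Mfac (p.1 + q.1) * uzSeq (hNorm t g) p.1 q.1) *
            (τ ^ (p.2 + q.2) / (p.2 + q.2).factorial * supSeq (hNorm t g) p.2 q.2)) :=
      Finset.sum_le_sum fun n _ => Finset.sum_le_sum fun c _ => Finset.sum_le_sum fun p hp =>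
        Finset.sum_le_sum fun q hq => by
          have := choose_mul_splitSeq_le hL hτ p.1 p.2 q.1 q.2
          rwa [Finset.HasAntidiagonal.mem_antidiagonal.1 hp,
            Finset.HasAntidiagonal.mem_antidiagonal.1 hq] at this
    _ = _ := by simp only [← Finset.mul_sum, Finset.sum_add_distrib]
    _ ≤ _ := mul_le_mul_of_nonneg_left (add_le_add c1 c2) (by norm_num : (0 : ℝ) ≤ 16)
    _ = _ := by ring

end conclusion

/-- estimate of the term `I₄`. -/
theorem estimate_I4 (τ₀ : ℝ) (hτ₀ : 0 < τ₀) :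
    ∃ C : ℝ, 0 < C ∧
      ∀ t : ℝ, 0 ≤ t → ∀ g : ℝ → ℝ → ℝ → ℝ, DecaySmooth g → L2cond t g → L2condZ t g →
        ∀ τ : ℝ, 0 < τ → τ ≤ τ₀ →
          Summable (Xel t τ g) → Summable (Yel t τ g) →
          ∀ N : ℕ,
            (∑ n ∈ Finset.range N, Qterm t τ g (I4 t g) n) ≤
              C / τ ^ 2 * angT t ^ (-(1 : ℝ) / 4) * (Xnrm t τ g + Ynrm t τ g) * Xnrm t τ g := by
  refine ⟨800 * ((5 + 4 * τ₀ + 2 * τ₀ ^ 2) + (2 + τ₀) * (1 + 2 * τ₀ + 2 * τ₀ ^ 2)),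
    by positivity, ?_⟩
  intro t ht g hg hL2 _ τ hτ hττ₀ hX hY N
  have hT : 0 < angT t := by
    unfold angT
    positivity
  have hX0 : 0 ≤ Xnrm t τ g := tsum_nonneg fun n => by
    rw [Xel_eq]
    exact Finset.sum_nonneg fun _ _ => xSeq_nonneg (hNorm_nonneg t g) hτ _ _
  have hY0 : 0 ≤ Ynrm t τ g := tsum_nonneg fun n => by
    rw [Yel_eq]
    exact Finset.sum_nonneg fun _ _ => ySeq_nonneg (hNorm_nonneg t g) hτ _ _
  refine (sum_Qterm_I4_le hT hτ hg.1 hL2 hX hY N).trans ?_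
  have hW : 0 ≤ angT t ^ (-(1 : ℝ) / 4) := Real.rpow_nonneg hT.le _
  generalize angT t ^ (-(1 : ℝ) / 4) = W at hW ⊢
  generalize Xnrm t τ g = X at hX0 ⊢
  generalize Ynrm t τ g = Y at hY0 ⊢
  have h1 : 2 * X + 4 * τ⁻¹ * X + (τ ^ 2)⁻¹ * (5 * X + 2 * Y) ≤
      (τ ^ 2)⁻¹ * ((5 + 4 * τ₀ + 2 * τ₀ ^ 2) * (X + Y)) := by
    calc _ = (τ ^ 2)⁻¹ * ((5 + 4 * τ + 2 * τ ^ 2) * X + 2 * Y) := by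
          field_simp
          ring
      _ ≤ (τ ^ 2)⁻¹ * ((5 + 4 * τ₀ + 2 * τ₀ ^ 2) * X + (5 + 4 * τ₀ + 2 * τ₀ ^ 2) * Y) := by
          gcongr
          nlinarith
      _ = _ := by ring
  have h2 : 2 * Y + 2 * X + τ * Y ≤ (2 + τ₀) * (X + Y) := by nlinarith
  have h3 : (2 + 2 * τ⁻¹ + (τ ^ 2)⁻¹) * X ≤ (τ ^ 2)⁻¹ * ((1 + 2 * τ₀ + 2 * τ₀ ^ 2) * X) := by
    calc _ = (τ ^ 2)⁻¹ * ((1 + 2 * τ + 2 * τ ^ 2) * X) := by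
          field_simp
          ring
      _ ≤ _ := by gcongr
  calc _ ≤ 50 * W * (16 * ((τ ^ 2)⁻¹ * ((5 + 4 * τ₀ + 2 * τ₀ ^ 2) * (X + Y)) * X +
        (2 + τ₀) * (X + Y) * ((τ ^ 2)⁻¹ * ((1 + 2 * τ₀ + 2 * τ₀ ^ 2) * X)))) := by gcongr
    _ = _ := by
        rw [div_eq_mul_inv]
        ring
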